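/- arXiv:2002.08814 — 5 statements merged into one kernel-verified Lean document; each statement's English description precedes it below -/
import Mathlib

section
/- Let n > 2 and q > 0 be integers such that n is even or q is odd, and let p be a prime with p > max{n, (q-1)n + 1}. Then the rational number ∑_{k=0}^{p-q} ((q - p/n)_k^n / (1)_k^n) · (∑_{i=0}^{k-1} 1/(q + i - p/n) - H_k^{(1)}) is congruent to 0 modulo p^2, i.e., its p-adic valuation is at least 2. -/
/-- `H m k` is the `k`-th harmonic number of order `m`: `H_k^{(m)} = ∑_{j=1}^k 1/j^m`. -/
def harm (m k : ℕ) : ℚ := ∑ j ∈ Finset.range k, 1 / ((j : ℚ) + 1) ^ m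

open Finset

/-- The subring of `ℚ` of rational numbers whose denominator is prime to `p`. -/
def pIntegers (p : ℕ) (hp : p.Prime) : Subring ℚ where
  carrier := {x | ¬ p ∣ x.den}
  mul_mem' {x y} hx hy h :=
    (hp.dvd_mul.1 (h.trans (Rat.mul_den_dvd x y))).elim hx hy
  add_mem' {x y} hx hy h :=
    (hp.dvd_mul.1 (h.trans (Rat.add_den_dvd x y))).elim hx hy
  one_mem' := by simpa using hp.one_lt.ne'
  zero_mem' := by simpa using hp.one_lt.ne'
  neg_mem' {x} hx := by simpa using hx

lemma inv_intCast_mem_pIntegers {p : ℕ} (hp : p.Prime) {z : ℤ} (hz : ¬ (p : ℤ) ∣ z) :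
    (z : ℚ)⁻¹ ∈ pIntegers p hp := by
  change ¬ p ∣ ((z : ℚ)⁻¹).den
  have hz0 : z ≠ 0 := by rintro rfl; simp at hz
  rw [Rat.inv_intCast_den, if_neg hz0]
  rwa [← Int.natCast_dvd]

lemma inv_natCast_mem_pIntegers {p : ℕ} (hp : p.Prime) {u : ℕ} (hu : ¬ p ∣ u) :
    (u : ℚ)⁻¹ ∈ pIntegers p hp := by
  have := inv_intCast_mem_pIntegers hp (z := u) (by exact_mod_cast hu)
  simpa using this

/-- Congruence of rational numbers modulo `p ^ e`. -/
def PCongr (p : ℕ) (hp : p.Prime) (e : ℕ) (x y : ℚ) : Prop :=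
  ∃ r ∈ pIntegers p hp, x = y + (p : ℚ) ^ e * r

namespace PCongr

variable {p : ℕ} {hp : p.Prime} {e : ℕ} {x y z w : ℚ}

lemma refl (x : ℚ) : PCongr p hp e x x := ⟨0, zero_mem _, by simp⟩

lemma add (h : PCongr p hp e x y) (h' : PCongr p hp e z w) : PCongr p hp e (x + z) (y + w) := by
  obtain ⟨r, hr, rfl⟩ := h
  obtain ⟨s, hs, rfl⟩ := h'
  exact ⟨r + s, add_mem hr hs, by ring⟩

lemma mul (h : PCongr p hp e x y) (h' : PCongr p hp e z w)
    (hy : y ∈ pIntegers p hp) (hw : w ∈ pIntegers p hp) : PCongr p hp e (x * z) (y * w) := by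
  obtain ⟨r, hr, rfl⟩ := h
  obtain ⟨s, hs, rfl⟩ := h'
  have hpe : (p : ℚ) ^ e ∈ pIntegers p hp := pow_mem (natCast_mem _ p) e
  exact ⟨y * s + r * w + (p : ℚ) ^ e * (r * s), add_mem (add_mem (mul_mem hy hs) (mul_mem hr hw))
    (mul_mem hpe (mul_mem hr hs)), by ring⟩

lemma sum {s : Finset ℕ} {f g : ℕ → ℚ} (h : ∀ i ∈ s, PCongr p hp e (f i) (g i)) :
    PCongr p hp e (∑ i ∈ s, f i) (∑ i ∈ s, g i) := by
  induction s using Finset.induction_on with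
  | empty => exact refl _
  | insert a s ha ih =>
    rw [sum_insert ha, sum_insert ha]
    exact (h a (mem_insert_self a s)).add (ih fun i hi ↦ h i (mem_insert_of_mem hi))

lemma prod {s : Finset ℕ} {f g : ℕ → ℚ} (h : ∀ i ∈ s, PCongr p hp e (f i) (g i))
    (hg : ∀ i ∈ s, g i ∈ pIntegers p hp) :
    PCongr p hp e (∏ i ∈ s, f i) (∏ i ∈ s, g i) := by
  induction s using Finset.induction_on with
  | empty => exact refl _
  | insert a s ha ih =>
    rw [prod_insert ha, prod_insert ha]
    exact (h a (mem_insert_self a s)).mul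
      (ih (fun i hi ↦ h i (mem_insert_of_mem hi)) fun i hi ↦ hg i (mem_insert_of_mem hi))
      (hg a (mem_insert_self a s))
      (prod_mem fun i hi ↦ hg i (mem_insert_of_mem hi))

lemma pow (h : PCongr p hp e x y) (hy : y ∈ pIntegers p hp) (n : ℕ) :
    PCongr p hp e (x ^ n) (y ^ n) := by
  induction n with
  | zero => simpa using refl 1
  | succ n ih => rw [pow_succ, pow_succ]; exact ih.mul h (pow_mem hy n) hy

end PCongr

/-- `(u - p c) ^ (n + 1) ≡ u ^ n (u - p (n + 1) c)` modulo `p ^ 2` for `p`-integral `u` and `c`. -/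
lemma pcongr_sub_div_pow {p : ℕ} (hp : p.Prime) {c u : ℚ} (hc : c ∈ pIntegers p hp)
    (hu : u ∈ pIntegers p hp) (n : ℕ) :
    PCongr p hp 2 ((u - p * c) ^ (n + 1)) (u ^ n * (u - p * ((n + 1 : ℕ) * c))) := by
  have hpm : (p : ℚ) ∈ pIntegers p hp := natCast_mem _ p
  induction n with
  | zero => simpa using PCongr.refl _
  | succ n ih =>
    obtain ⟨r, hr, h⟩ := ih
    refine ⟨u ^ n * ((n + 1 : ℕ) * c) * c + r * (u - p * c), ?_, ?_⟩
    · exact add_mem (mul_mem (mul_mem (pow_mem hu n) (mul_mem (natCast_mem _ _) hc)) hc)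
        (mul_mem hr (sub_mem hu (mul_mem hpm hc)))
    · rw [pow_succ, h]; push_cast; ring

/-- The alternating binomial sum of a polynomial of degree less than `N` vanishes. -/
lemma sum_alternating_choose_mul_prod_pow (N m : ℕ) (e : ℕ → ℕ) (h : ∑ r ∈ range m, e r < N) :
    ∑ k ∈ range (N + 1), ((-1 : ℚ) ^ k * N.choose k) *
      ∏ r ∈ range m, ((k : ℚ) + r + 1) ^ e r = 0 := by
  let P : Polynomial ℚ := ∏ r ∈ range m, (Polynomial.X + Polynomial.C ((r : ℚ) + 1)) ^ e r
  have hP : P.natDegree < N := by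
    refine lt_of_le_of_lt (Polynomial.natDegree_prod_le _ _) (lt_of_le_of_lt (sum_le_sum ?_) h)
    intro r _
    refine Polynomial.natDegree_pow_le.trans ?_
    rw [Polynomial.natDegree_X_add_C, mul_one]
  have h0 := congrFun (Polynomial.fwdDiff_iter_eq_zero_of_degree_lt hP) 0
  rw [fwdDiff_iter_eq_sum_shift] at h0
  have h1 : ∀ k ∈ range (N + 1), ((-1 : ℚ) ^ k * N.choose k) *
      ∏ r ∈ range m, ((k : ℚ) + r + 1) ^ e r =
      (-1) ^ N * (((-1 : ℤ) ^ (N - k) * N.choose k) • P.eval (0 + k • (1 : ℚ))) := by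
    intro k hk
    have hk' : k ≤ N := by simpa [Nat.lt_succ_iff] using hk
    have hs : (-1 : ℚ) ^ N * (-1) ^ (N - k) = (-1) ^ k := by
      obtain ⟨d, rfl⟩ := Nat.exists_eq_add_of_le hk'
      rw [Nat.add_sub_cancel_left, pow_add, mul_assoc, ← mul_pow]
      simp
    simp only [P, Polynomial.eval_prod, Polynomial.eval_pow, Polynomial.eval_add,
      Polynomial.eval_X, Polynomial.eval_C, zsmul_eq_mul, nsmul_eq_mul, zero_add, mul_one,
      ← add_assoc]
    push_cast
    rw [← hs]
    ring
  rw [sum_congr rfl h1, ← mul_sum, h0]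
  simp

/-- The binomial coefficient `(k + m).choose m` as a polynomial in `k`. -/
def polyChoose (m k : ℕ) : ℚ := (∏ r ∈ range m, ((k : ℚ) + r + 1)) / (m.factorial : ℚ)

lemma sum_alternating_choose_mul_polyChoose_pow (N m l : ℕ) (h : m * l < N) :
    ∑ k ∈ range (N + 1), ((-1 : ℚ) ^ k * N.choose k) * polyChoose m k ^ l = 0 := by
  have h0 := sum_alternating_choose_mul_prod_pow N m (fun _ ↦ l) (by simpa using h)
  rw [← zero_div ((m.factorial : ℚ) ^ l), ← h0, sum_div]
  refine sum_congr rfl fun k _ ↦ ?_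
  rw [polyChoose, div_pow, prod_pow]
  ring

lemma sum_alternating_choose_mul_polyChoose_pow_div (N m l j : ℕ) (h : m * l < N) (hj : j ≤ l)
    {r : ℕ} (hr : r < m) :
    ∑ k ∈ range (N + 1), ((-1 : ℚ) ^ k * N.choose k) * polyChoose m k ^ l *
      (1 / ((k : ℚ) + r + 1) ^ j) = 0 := by
  have h0 := sum_alternating_choose_mul_prod_pow N m (fun s ↦ l - if s = r then j else 0) (by
    refine lt_of_le_of_lt (sum_le_sum (g := fun _ ↦ l) fun s _ ↦ Nat.sub_le _ _) ?_
    simpa using h)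
  rw [← zero_div ((m.factorial : ℚ) ^ l), ← h0, sum_div]
  refine sum_congr rfl fun k _ ↦ ?_
  have hk : ((k : ℚ) + r + 1) ≠ 0 := by positivity
  have h1 : (∏ s ∈ range m, ((k : ℚ) + s + 1)) ^ l =
      (∏ s ∈ range m, ((k : ℚ) + s + 1) ^ (l - if s = r then j else 0)) *
        ((k : ℚ) + r + 1) ^ j := by
    have h2 : ((k : ℚ) + r + 1) ^ j =
        ∏ s ∈ range m, ((k : ℚ) + s + 1) ^ (if s = r then j else 0) := by
      rw [prod_eq_single_of_mem r (mem_range.2 hr)]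
      · simp
      · intro s _ hs; simp [hs]
    rw [h2, ← prod_mul_distrib, ← prod_pow]
    refine prod_congr rfl fun s _ ↦ ?_
    rw [← pow_add]
    congr 1
    split_ifs <;> omega
  rw [polyChoose, div_pow, h1]
  field_simp

lemma sum_range_shift_sub_sum_range {f : ℕ → ℚ} (m k : ℕ) :
    ∑ i ∈ range k, f (m + i) - ∑ i ∈ range k, f i =
      ∑ r ∈ range m, f (k + r) - ∑ r ∈ range m, f r := by
  have h1 := sum_range_add f m k
  have h2 := sum_range_add f k m
  rw [add_comm k m] at h2
  linarith

lemma prod_range_add_div_factorial (m k : ℕ) :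
    (∏ i ∈ range k, ((m : ℚ) + 1 + i)) / (k.factorial : ℚ) = polyChoose m k := by
  have hf : ∀ a b : ℕ, ∏ i ∈ range b, ((a : ℚ) + 1 + i) = (a + b).factorial / (a.factorial : ℚ) := by
    intro a b
    have ha : (a.factorial : ℚ) ≠ 0 := by positivity
    rw [eq_div_iff ha, ← Nat.factorial_mul_ascFactorial, Nat.ascFactorial_eq_prod_range]
    push_cast
    ring
  have hG : ∏ r ∈ range m, ((k : ℚ) + r + 1) = ∏ r ∈ range m, ((k : ℚ) + 1 + r) :=
    prod_congr rfl fun r _ ↦ by ring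
  rw [polyChoose, hG, hf, hf, add_comm k m, div_right_comm]

lemma prod_range_sub_div_factorial (N k : ℕ) :
    (∏ i ∈ range k, ((i : ℚ) - N)) / (k.factorial : ℚ) = (-1) ^ k * N.choose k := by
  have hk : (k.factorial : ℚ) ≠ 0 := by positivity
  rw [div_eq_iff hk, mul_assoc, ← Nat.cast_mul, mul_comm (N.choose k),
    ← Nat.descFactorial_eq_factorial_mul_choose]
  induction k with
  | zero => simp
  | succ k ih =>
    rw [prod_range_succ, ih (by positivity), Nat.descFactorial_succ]
    rcases le_or_gt k N with h | h
    · rw [Nat.cast_mul, Nat.cast_sub h]; ring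
    · rw [Nat.descFactorial_eq_zero_iff_lt.2 h]; simp

lemma polyChoose_mem_pIntegers {p : ℕ} (hp : p.Prime) {m : ℕ} (hm : m < p) (k : ℕ) :
    polyChoose m k ∈ pIntegers p hp := by
  rw [polyChoose, div_eq_mul_inv]
  refine mul_mem (prod_mem fun r _ ↦ ?_)
    (inv_natCast_mem_pIntegers hp (by rw [hp.dvd_factorial]; omega))
  exact_mod_cast natCast_mem (pIntegers p hp) (k + r + 1)

lemma polyChoose_reflect {p N m : ℕ} (hp : p.Prime) (hpN : p = N + m + 1) {k : ℕ} (hk : k ≤ N) :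
    PCongr p hp 1 (polyChoose m (N - k)) ((-1) ^ m * polyChoose m k) := by
  have hr : (-1 : ℚ) ^ m * polyChoose m k =
      (∏ r ∈ range m, -((k : ℚ) + r + 1)) * ((m.factorial : ℚ))⁻¹ := by
    rw [polyChoose, prod_neg, card_range]; ring
  rw [hr, polyChoose, ← prod_range_reflect, div_eq_mul_inv]
  have hmem : ∀ r ∈ range m, -((k : ℚ) + r + 1) ∈ pIntegers p hp := fun r _ ↦
    neg_mem (by exact_mod_cast natCast_mem (pIntegers p hp) (k + r + 1))
  refine (PCongr.prod (fun r hr ↦ ?_) hmem).mul (PCongr.refl _) (prod_mem hmem)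
    (inv_natCast_mem_pIntegers hp (by rw [hp.dvd_factorial]; omega))
  refine ⟨1, one_mem _, ?_⟩
  have hrm : r + 1 ≤ m := mem_range.1 hr
  rw [Nat.sub_sub, add_comm 1 r, Nat.cast_sub hk, Nat.cast_sub hrm, hpN]
  push_cast
  ring

lemma sum_inv_sq_reflect {p N m : ℕ} (hp : p.Prime) (hpN : p = N + m + 1) {k : ℕ} (hk : k ≤ N) :
    PCongr p hp 1 (∑ i ∈ range (N - k), 1 / (((m + i : ℕ) : ℚ) + 1) ^ 2)
      (∑ i ∈ range (N - k), 1 / (((k + i : ℕ) : ℚ) + 1) ^ 2) := by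
  rw [← sum_range_reflect]
  refine PCongr.sum fun i hi ↦ ?_
  have hi' : k + i + 1 ≤ N := by have := mem_range.1 hi; omega
  obtain ⟨b, hb⟩ : ∃ b, m + (N - k - 1 - i) + 1 = b := ⟨_, rfl⟩
  have hab : (k + i + 1) + b = p := by omega
  have hb1 : (((m + (N - k - 1 - i) : ℕ) : ℚ) + 1) = b := by exact_mod_cast hb
  have ha1 : (((k + i : ℕ) : ℚ) + 1) = (k + i + 1 : ℕ) := by push_cast; ring
  have ha0 : 0 < k + i + 1 := by omega
  have hb0 : 0 < b := by omega
  rw [hb1, ha1]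
  generalize k + i + 1 = a at *
  have ha := inv_natCast_mem_pIntegers hp (Nat.not_dvd_of_pos_of_lt ha0 (by omega : a < p))
  have hb' := inv_natCast_mem_pIntegers hp (Nat.not_dvd_of_pos_of_lt hb0 (by omega : b < p))
  refine ⟨((a : ℚ) - b) * ((a : ℚ)⁻¹ ^ 2 * (b : ℚ)⁻¹ ^ 2),
    mul_mem (sub_mem (natCast_mem _ _) (natCast_mem _ _))
      (mul_mem (pow_mem ha 2) (pow_mem hb' 2)), ?_⟩
  have h1 : (a : ℚ) ≠ 0 := by positivity
  have h2 : (b : ℚ) ≠ 0 := by positivity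
  rw [← hab]
  push_cast
  field_simp
  ring

lemma sum_inv_sq_mem_pIntegers {p j k : ℕ} (hp : p.Prime) (hk : j + k < p) :
    ∑ i ∈ range k, 1 / (((j + i : ℕ) : ℚ) + 1) ^ 2 ∈ pIntegers p hp := by
  refine sum_mem fun i hi ↦ ?_
  have hi' := mem_range.1 hi
  have h := inv_natCast_mem_pIntegers hp
    (Nat.not_dvd_of_pos_of_lt (by omega : 0 < j + i + 1) (by omega : j + i + 1 < p))
  simpa using pow_mem h 2

lemma sum_alternating_choose_mul_sum_inv_sq {p N m l : ℕ} (hp : p.Prime) (hpN : p = N + m + 1)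
    (hodd : Odd p) (hl : 2 ≤ l) (hml : m * l < N) (hpar : Even (m * (l + 1))) :
    PCongr p hp 1 (∑ k ∈ range (N + 1), ((-1 : ℚ) ^ k * N.choose k) * polyChoose m k ^ l *
      ∑ i ∈ range k, 1 / (((m + i : ℕ) : ℚ) + 1) ^ 2) 0 := by
  set t : ℕ → ℚ := fun k ↦ ((-1 : ℚ) ^ k * N.choose k) * polyChoose m k ^ l *
      ∑ i ∈ range k, 1 / (((m + i : ℕ) : ℚ) + 1) ^ 2 with ht
  set f : ℕ → ℚ := fun i ↦ 1 / ((i : ℚ) + 1) ^ 2 with hf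
  have hmp : m < p := by omega
  have hA : ∀ k, ((-1 : ℚ) ^ k * N.choose k) ∈ pIntegers p hp := fun k ↦
    mul_mem (pow_mem (neg_mem (one_mem _)) k) (natCast_mem _ _)
  have hG := polyChoose_mem_pIntegers hp hmp
  have hsign : (-1 : ℚ) ^ N * ((-1) ^ m) ^ l = 1 := by
    rw [← pow_mul, ← pow_add]
    refine Even.neg_one_pow ?_
    subst hpN
    rw [mul_add, mul_one] at hpar
    grind
  have hrefl : ∀ k ∈ range (N + 1), PCongr p hp 1 (t k + t (N - k))
      (((-1 : ℚ) ^ k * N.choose k) * polyChoose m k ^ l *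
        (∑ r ∈ range m, f (k + r) + (∑ i ∈ range N, f i - ∑ r ∈ range m, f r))) := by
    intro k hk
    have hk' : k ≤ N := by simpa [Nat.lt_succ_iff] using hk
    have h1 : t (N - k) = ((-1 : ℚ) ^ N * ((-1 : ℚ) ^ k * N.choose k)) *
        polyChoose m (N - k) ^ l *
        ∑ i ∈ range (N - k), 1 / (((m + i : ℕ) : ℚ) + 1) ^ 2 := by
      have hs : (-1 : ℚ) ^ (N - k) = (-1) ^ N * (-1) ^ k := by
        obtain ⟨d, rfl⟩ := Nat.exists_eq_add_of_le hk'
        rw [Nat.add_sub_cancel_left, pow_add, mul_right_comm, ← mul_pow]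
        simp
      simp only [ht]
      rw [hs, Nat.choose_symm hk']
      ring
    have hGr : (-1) ^ m * polyChoose m k ∈ pIntegers p hp :=
      mul_mem (pow_mem (neg_mem (one_mem _)) m) (hG k)
    have hAr : (-1 : ℚ) ^ N * ((-1 : ℚ) ^ k * N.choose k) ∈ pIntegers p hp :=
      mul_mem (pow_mem (neg_mem (one_mem _)) N) (hA k)
    have h2 := ((PCongr.refl (p := p) (hp := hp) (e := 1)
        ((-1 : ℚ) ^ N * ((-1 : ℚ) ^ k * N.choose k))).mul
      ((polyChoose_reflect hp hpN hk').pow hGr l) hAr (pow_mem hGr l)).mul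
      (sum_inv_sq_reflect hp hpN hk') (mul_mem hAr (pow_mem hGr l))
      (sum_inv_sq_mem_pIntegers hp (by omega))
    rw [← h1] at h2
    have h3 := (PCongr.refl (p := p) (hp := hp) (e := 1) (t k)).add h2
    convert h3 using 1
    have h4 := sum_range_shift_sub_sum_range (f := f) m k
    have h5 := sum_range_add f k (N - k)
    rw [Nat.add_sub_cancel' hk'] at h5
    have h6 : ∑ r ∈ range m, f (k + r) + (∑ i ∈ range N, f i - ∑ r ∈ range m, f r) =
        ∑ i ∈ range k, f (m + i) + ∑ i ∈ range (N - k), f (k + i) := by linarith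
    rw [h6, mul_pow]
    simp only [ht, hf]
    linear_combination (-((-1 : ℚ) ^ k * N.choose k) * polyChoose m k ^ l *
      ∑ i ∈ range (N - k), 1 / (((k + i : ℕ) : ℚ) + 1) ^ 2) * hsign
  have hsum := PCongr.sum hrefl
  have hzero : ∑ k ∈ range (N + 1), ((-1 : ℚ) ^ k * N.choose k) * polyChoose m k ^ l *
      (∑ r ∈ range m, f (k + r) + (∑ i ∈ range N, f i - ∑ r ∈ range m, f r)) = 0 := by
    simp_rw [mul_add, sum_add_distrib, ← sum_mul,
      sum_alternating_choose_mul_polyChoose_pow N m l hml, zero_mul, mul_sum]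
    rw [add_zero, sum_comm]
    refine sum_eq_zero fun r hr ↦ ?_
    simpa [hf] using
      sum_alternating_choose_mul_polyChoose_pow_div N m l 2 hml hl (mem_range.1 hr)
  have hflip : ∑ k ∈ range (N + 1), t (N - k) = ∑ k ∈ range (N + 1), t k := sum_range_reflect t _
  rw [hzero, sum_add_distrib, hflip] at hsum
  obtain ⟨r, hr, h⟩ := hsum
  have h2 := inv_natCast_mem_pIntegers hp (u := 2) (fun h ↦ by
    have := (Nat.prime_dvd_prime_iff_eq hp Nat.prime_two).1 h
    subst this; exact absurd hodd (by decide))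
  refine ⟨_, mul_mem h2 hr, ?_⟩
  push_cast
  linear_combination h / 2

lemma sum_alternating_choose_mul_sum_inv_sub_harm {N m l : ℕ} (hl : 1 ≤ l) (hml : m * l < N) :
    ∑ k ∈ range (N + 1), ((-1 : ℚ) ^ k * N.choose k) * polyChoose m k ^ l *
      (∑ i ∈ range k, 1 / ((m : ℚ) + 1 + i) - harm 1 k) = 0 := by
  set f : ℕ → ℚ := fun i ↦ 1 / ((i : ℚ) + 1) ^ 1 with hf
  have h1 : ∀ k, ∑ i ∈ range k, 1 / ((m : ℚ) + 1 + i) - harm 1 k =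
      ∑ r ∈ range m, f (k + r) - ∑ r ∈ range m, f r := by
    intro k
    rw [← sum_range_shift_sub_sum_range, harm]
    congr 1
    refine sum_congr rfl fun i _ ↦ ?_
    simp only [hf]; push_cast; ring
  simp_rw [h1, mul_sub, sum_sub_distrib, ← sum_mul,
    sum_alternating_choose_mul_polyChoose_pow N m l hml, zero_mul, mul_sum]
  rw [sub_zero, sum_comm]
  refine sum_eq_zero fun r hr ↦ ?_
  simpa [hf] using
    sum_alternating_choose_mul_polyChoose_pow_div N m l 1 hml hl (mem_range.1 hr)

lemma pcongr_pochhammer_pow {p N m l : ℕ} (hp : p.Prime) (hpN : p = N + m + 1) (hlp : l + 1 < p)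
    {k : ℕ} (hk : k ≤ N) :
    PCongr p hp 2 ((∏ i ∈ range k, ((m : ℚ) + 1 + i - p * ((l + 1 : ℕ) : ℚ)⁻¹)) ^ (l + 1) /
      (k.factorial : ℚ) ^ (l + 1)) (((-1 : ℚ) ^ k * N.choose k) * polyChoose m k ^ l) := by
  have hc := inv_natCast_mem_pIntegers hp (Nat.not_dvd_of_pos_of_lt l.succ_pos hlp)
  have hf := inv_natCast_mem_pIntegers hp (u := k.factorial) (by rw [hp.dvd_factorial]; omega)
  have hu : ∀ i : ℕ, (m : ℚ) + 1 + i ∈ pIntegers p hp := fun i ↦ by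
    exact_mod_cast natCast_mem (pIntegers p hp) (m + 1 + i)
  have hi : ∀ i : ℕ, (i : ℚ) - N ∈ pIntegers p hp := fun i ↦
    sub_mem (natCast_mem _ _) (natCast_mem _ _)
  have hmem : ∀ i ∈ range k, ((m : ℚ) + 1 + i) ^ l * ((i : ℚ) - N) ∈ pIntegers p hp := fun i _ ↦
    mul_mem (pow_mem (hu i) l) (hi i)
  have h := (PCongr.prod (e := 2)
    (f := fun i ↦ ((m : ℚ) + 1 + i - p * ((l + 1 : ℕ) : ℚ)⁻¹) ^ (l + 1))
    (fun i _ ↦ by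
      have h := pcongr_sub_div_pow hp hc (hu i) l
      rw [mul_inv_cancel₀ (by positivity)] at h
      convert h using 2
      rw [hpN]; push_cast; ring) hmem).mul (PCongr.refl (((k.factorial : ℚ))⁻¹ ^ (l + 1)))
      (prod_mem hmem) (pow_mem hf _)
  convert h using 1
  · rw [prod_pow, inv_pow, div_eq_mul_inv]
  · rw [← prod_range_sub_div_factorial, ← prod_range_add_div_factorial, prod_mul_distrib, prod_pow,
      div_pow, pow_succ, inv_pow, div_eq_mul_inv, div_eq_mul_inv]
    ring

lemma pcongr_sum_inv_sub {p N m l : ℕ} (hp : p.Prime) (hpN : p = N + m + 1) (hlp : l + 1 < p)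
    {k : ℕ} (hk : k ≤ N) :
    PCongr p hp 2 (∑ i ∈ range k, 1 / ((m : ℚ) + 1 + i - p * ((l + 1 : ℕ) : ℚ)⁻¹))
      (∑ i ∈ range k, 1 / ((m : ℚ) + 1 + i) +
        p * ((l + 1 : ℕ) : ℚ)⁻¹ * ∑ i ∈ range k, 1 / (((m + i : ℕ) : ℚ) + 1) ^ 2) := by
  rw [mul_sum, ← sum_add_distrib]
  refine PCongr.sum fun i hi ↦ ?_
  have hi' := mem_range.1 hi
  have hu1 : (m : ℚ) + 1 + i = (m + i + 1 : ℕ) := by push_cast; ring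
  have hu2 : (((m + i : ℕ) : ℚ) + 1) = (m + i + 1 : ℕ) := by push_cast; ring
  rw [hu1, hu2]
  have hnu : ¬ p ∣ m + i + 1 := Nat.not_dvd_of_pos_of_lt (by omega) (by omega)
  have hu0 : 0 < m + i + 1 := by omega
  generalize m + i + 1 = u at *
  have hnl : ¬ p ∣ l + 1 := Nat.not_dvd_of_pos_of_lt l.succ_pos hlp
  have hl0 : 0 < l + 1 := l.succ_pos
  generalize l + 1 = n at *
  have hz : ¬ (p : ℤ) ∣ (n : ℤ) * u - p := by
    intro h
    have h' := (dvd_sub_self_right).1 h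
    have h'' : p ∣ n * u := by exact_mod_cast h'
    exact (hp.dvd_mul.1 h'').elim hnl hnu
  have hz0 : (n : ℚ) * u - p ≠ 0 := by
    intro h
    have : (n : ℤ) * u - p = 0 := by exact_mod_cast h
    rw [this] at hz
    exact hz (dvd_zero _)
  have hzi := inv_intCast_mem_pIntegers hp hz
  push_cast at hzi
  have hui := inv_natCast_mem_pIntegers hp hnu
  have hni := inv_natCast_mem_pIntegers hp hnl
  refine ⟨(n : ℚ)⁻¹ * (u : ℚ)⁻¹ ^ 2 * ((n : ℚ) * u - p)⁻¹,
    mul_mem (mul_mem hni (pow_mem hui 2)) hzi, ?_⟩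
  have h1 : (n : ℚ) ≠ 0 := by positivity
  have h2 : (u : ℚ) ≠ 0 := by positivity
  have h3 : (u : ℚ) - p * (n : ℚ)⁻¹ = ((n : ℚ) * u - p) / n := by field_simp
  rw [h3]
  field_simp
  ring

lemma ascPochhammer_eval_eq_prod_range (k : ℕ) (x : ℚ) :
    (ascPochhammer ℚ k).eval x = ∏ i ∈ range k, (x + i) := by
  induction k with
  | zero => simp
  | succ k ih => rw [ascPochhammer_succ_eval, ih, prod_range_succ]

/-- For integers `n > 2` and `q > 0` with `n` even or `q` odd, and any prime
`p > max {n, (q-1)n+1}`, the rational number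
`∑_{k=0}^{p-q} ((q - p/n)_k^n / (1)_k^n) (∑_{i=0}^{k-1} 1/(q+i-p/n) - H_k^{(1)})`
is congruent to `0` modulo `p^2`, i.e. it can be written as `p^2 * a / b` with `p ∤ b`. -/
theorem stmt_12 (n q : ℕ) (hn : 2 < n) (hq : 0 < q) (hpar : Even n ∨ Odd q)
    (p : ℕ) (hp : p.Prime) (hgt : p > max n ((q - 1) * n + 1)) :
    ∃ a b : ℤ, ¬ ((p : ℤ) ∣ b) ∧
      ∑ k ∈ Finset.range (p - q + 1),
          (((ascPochhammer ℚ k).eval ((q : ℚ) - (p : ℚ) / (n : ℚ))) ^ n /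
              ((ascPochhammer ℚ k).eval 1) ^ n) *
            ((∑ i ∈ Finset.range k, 1 / ((q : ℚ) + (i : ℚ) - (p : ℚ) / (n : ℚ))) - harm 1 k)
        = (p : ℚ) ^ 2 * a / b := by
  obtain ⟨m, rfl⟩ : ∃ m, q = m + 1 := ⟨q - 1, by omega⟩
  obtain ⟨l, rfl⟩ : ∃ l, n = l + 1 := ⟨n - 1, by omega⟩
  have hlp : l + 1 < p := lt_of_le_of_lt (le_max_left _ _) hgt
  have hmp : m * (l + 1) + 1 < p := lt_of_le_of_lt (le_max_right _ _) hgt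
  have hmul : m * (l + 1) = m * l + m := by ring
  obtain ⟨N, hN⟩ : ∃ N, p - (m + 1) = N := ⟨_, rfl⟩
  have hpN : p = N + m + 1 := by omega
  have hml : m * l < N := by omega
  have hodd : Odd p := hp.odd_of_ne_two (by omega)
  have hev : Even (m * (l + 1)) := by
    rcases hpar with h | h
    · exact h.mul_left m
    · exact Even.mul_right (by simpa [Nat.odd_add_one] using h) _
  have hc := inv_natCast_mem_pIntegers hp (Nat.not_dvd_of_pos_of_lt l.succ_pos hlp)
  set c : ℚ := ((l + 1 : ℕ) : ℚ)⁻¹ with hcdef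
  have hpm : (p : ℚ) ∈ pIntegers p hp := natCast_mem _ p
  have key : ∀ k ∈ range (N + 1), PCongr p hp 2
      (((ascPochhammer ℚ k).eval (((m + 1 : ℕ) : ℚ) - (p : ℚ) / ((l + 1 : ℕ) : ℚ))) ^ (l + 1) /
        ((ascPochhammer ℚ k).eval 1) ^ (l + 1) *
        ((∑ i ∈ range k, 1 / (((m + 1 : ℕ) : ℚ) + (i : ℚ) - (p : ℚ) / ((l + 1 : ℕ) : ℚ)))
          - harm 1 k))
      (((-1 : ℚ) ^ k * N.choose k) * polyChoose m k ^ l *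
        (∑ i ∈ range k, 1 / ((m : ℚ) + 1 + i) +
          p * c * ∑ i ∈ range k, 1 / (((m + i : ℕ) : ℚ) + 1) ^ 2 + -harm 1 k)) := by
    intro k hk
    have hk' : k ≤ N := by simpa [Nat.lt_succ_iff] using hk
    have hinv : ∀ j i : ℕ, i < k → j + k < p → 1 / ((j : ℚ) + 1 + i) ∈ pIntegers p hp := by
      intro j i hi hj
      have := inv_natCast_mem_pIntegers hp
        (Nat.not_dvd_of_pos_of_lt (by omega : 0 < j + 1 + i) (by omega : j + 1 + i < p))
      simpa using this
    have hharm : harm 1 k ∈ pIntegers p hp := by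
      refine sum_mem fun i hi ↦ ?_
      have := hinv 0 i (mem_range.1 hi) (by omega)
      simpa [add_comm] using this
    have h := (pcongr_pochhammer_pow hp hpN hlp hk').mul
      ((pcongr_sum_inv_sub hp hpN hlp hk').add (PCongr.refl (-harm 1 k)))
      (mul_mem (mul_mem (pow_mem (neg_mem (one_mem _)) k) (natCast_mem _ _))
        (pow_mem (polyChoose_mem_pIntegers hp (by omega) k) l))
      (add_mem (add_mem (sum_mem fun i hi ↦ hinv m i (mem_range.1 hi) (by omega))
        (mul_mem (mul_mem hpm hc) (sum_inv_sq_mem_pIntegers hp (by omega))))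
        (neg_mem hharm))
    convert h using 1
    have e1 : ∀ i : ℕ, ((m + 1 : ℕ) : ℚ) - (p : ℚ) / ((l + 1 : ℕ) : ℚ) + i =
        (m : ℚ) + 1 + i - p * c := fun i ↦ by rw [hcdef]; push_cast; ring
    have e2 : ∀ i : ℕ, ((m + 1 : ℕ) : ℚ) + i - (p : ℚ) / ((l + 1 : ℕ) : ℚ) =
        (m : ℚ) + 1 + i - p * c := fun i ↦ by rw [hcdef]; push_cast; ring
    simp_rw [ascPochhammer_eval_eq_prod_range _ (_ - _), ascPochhammer_eval_one, e1, e2,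
      sub_eq_add_neg _ (harm 1 k)]
    rfl
  obtain ⟨r, hr, h⟩ := PCongr.sum key
  obtain ⟨s, hs, h'⟩ := sum_alternating_choose_mul_sum_inv_sq hp hpN hodd (by omega) hml hev
  have hsplit : ∑ k ∈ range (N + 1), ((-1 : ℚ) ^ k * N.choose k) * polyChoose m k ^ l *
        (∑ i ∈ range k, 1 / ((m : ℚ) + 1 + i) +
          p * c * ∑ i ∈ range k, 1 / (((m + i : ℕ) : ℚ) + 1) ^ 2 + -harm 1 k) =
      (p : ℚ) ^ 2 * (c * s) := by
    have h0 := sum_alternating_choose_mul_sum_inv_sub_harm (N := N) (m := m) (l := l)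
      (by omega) hml
    calc _ = ∑ k ∈ range (N + 1), (((-1 : ℚ) ^ k * N.choose k) * polyChoose m k ^ l *
          (∑ i ∈ range k, 1 / ((m : ℚ) + 1 + i) - harm 1 k) +
          p * c * (((-1 : ℚ) ^ k * N.choose k) * polyChoose m k ^ l *
            ∑ i ∈ range k, 1 / (((m + i : ℕ) : ℚ) + 1) ^ 2)) :=
          sum_congr rfl fun k _ ↦ by ring
      _ = _ := by rw [sum_add_distrib, h0, ← mul_sum, h']; ring
  have hmem : c * s + r ∈ pIntegers p hp := add_mem (mul_mem hc hs) hr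
  refine ⟨(c * s + r).num, (c * s + r).den, by exact_mod_cast hmem, ?_⟩
  rw [hN, h, hsplit, mul_div_assoc, Int.cast_natCast, Rat.num_div_den]
  ring
end

section
/- Let n > 2 and q > 0 be integers such that n is even or q is odd, and let p be a prime with p > max{n, (q-1)n + 1}. Then the rational number ∑_{k=0}^{p-q} ((q - p/n)_k^n / (1)_k^n) · (∑_{i=0}^{k-1} 1/(q + i - p/n) - H_k^{(1)})^2 is congruent to 0 modulo p, i.e., its p-adic valuation is at least 1. -/
open Polynomial

/-- The rational number `r` is `p`-integral and its residue modulo `p` is `z`. -/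
def ReducesTo (p : ℕ) (r : ℚ) (z : ZMod p) : Prop :=
  ∃ a b : ℤ, (b : ZMod p) ≠ 0 ∧ r * b = a ∧ z * b = a

namespace ReducesTo

variable {p : ℕ} {r s : ℚ} {z w : ZMod p}

theorem natCast [Fact p.Prime] (m : ℕ) : ReducesTo p m m :=
  ⟨m, 1, by simp, by simp, by simp⟩

theorem add [Fact p.Prime] (h : ReducesTo p r z) (h' : ReducesTo p s w) :
    ReducesTo p (r + s) (z + w) := by
  obtain ⟨a, b, hb, hr, hz⟩ := h
  obtain ⟨c, d, hd, hs, hw⟩ := h'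
  refine ⟨a * d + c * b, b * d, ?_, ?_, ?_⟩
  · push_cast
    exact mul_ne_zero hb hd
  · push_cast
    rw [← hr, ← hs]
    ring
  · push_cast
    rw [← hz, ← hw]
    ring

theorem mul [Fact p.Prime] (h : ReducesTo p r z) (h' : ReducesTo p s w) :
    ReducesTo p (r * s) (z * w) := by
  obtain ⟨a, b, hb, hr, hz⟩ := h
  obtain ⟨c, d, hd, hs, hw⟩ := h'
  refine ⟨a * c, b * d, ?_, ?_, ?_⟩
  · push_cast
    exact mul_ne_zero hb hd
  · push_cast
    rw [← hr, ← hs]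
    ring
  · push_cast
    rw [← hz, ← hw]
    ring

theorem neg (h : ReducesTo p r z) : ReducesTo p (-r) (-z) := by
  obtain ⟨a, b, hb, hr, hz⟩ := h
  exact ⟨-a, b, hb, by simp [hr], by simp [hz]⟩

theorem sub [Fact p.Prime] (h : ReducesTo p r z) (h' : ReducesTo p s w) :
    ReducesTo p (r - s) (z - w) := by
  simpa only [sub_eq_add_neg] using h.add h'.neg

theorem inv [Fact p.Prime] (h : ReducesTo p r z) (hz0 : z ≠ 0) : ReducesTo p r⁻¹ z⁻¹ := by
  obtain ⟨a, b, hb, hr, hz⟩ := h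
  have ha : (a : ZMod p) ≠ 0 := hz ▸ mul_ne_zero hz0 hb
  have hr0 : r ≠ 0 := by
    rintro rfl
    have : a = 0 := by exact_mod_cast (by simpa using hr.symm : (a : ℚ) = 0)
    simp [this] at ha
  refine ⟨b, a, ha, ?_, ?_⟩
  · rw [← hr, inv_mul_cancel_left₀ hr0]
  · rw [← hz, inv_mul_cancel_left₀ hz0]

theorem div [Fact p.Prime] (h : ReducesTo p r z) (h' : ReducesTo p s w) (hw : w ≠ 0) :
    ReducesTo p (r / s) (z / w) := by
  simpa only [div_eq_mul_inv] using h.mul (h'.inv hw)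

theorem pow [Fact p.Prime] (h : ReducesTo p r z) (m : ℕ) : ReducesTo p (r ^ m) (z ^ m) := by
  induction m with
  | zero => simpa using natCast (p := p) 1
  | succ m ih => simpa only [pow_succ] using ih.mul h

theorem sum_range [Fact p.Prime] {f : ℕ → ℚ} {g : ℕ → ZMod p} (m : ℕ)
    (h : ∀ i < m, ReducesTo p (f i) (g i)) :
    ReducesTo p (∑ i ∈ Finset.range m, f i) (∑ i ∈ Finset.range m, g i) := by
  induction m with
  | zero => simpa using natCast (p := p) 0
  | succ m ih =>
    rw [Finset.sum_range_succ, Finset.sum_range_succ]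
    exact (ih fun i hi => h i (by omega)).add (h m (by omega))

theorem ascPochhammer_eval [Fact p.Prime] (h : ReducesTo p r z) (k : ℕ) :
    ReducesTo p ((ascPochhammer ℚ k).eval r) ((ascPochhammer (ZMod p) k).eval z) := by
  induction k with
  | zero => simpa using natCast (p := p) 1
  | succ k ih =>
    rw [ascPochhammer_succ_eval, ascPochhammer_succ_eval]
    exact ih.mul (h.add (natCast k))

theorem exists_eq_mul_div (h : ReducesTo p r 0) :
    ∃ a b : ℤ, ¬ ((p : ℤ) ∣ b) ∧ r = (p : ℚ) * a / b := by
  obtain ⟨a, b, hb, hr, hz⟩ := h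
  obtain ⟨c, rfl⟩ := (ZMod.intCast_zmod_eq_zero_iff_dvd a p).1 (by simpa using hz.symm)
  refine ⟨c, b, fun hd => hb ((ZMod.intCast_zmod_eq_zero_iff_dvd b p).2 hd), ?_⟩
  have hb0 : (b : ℚ) ≠ 0 := by
    rintro h0
    have : b = 0 := by exact_mod_cast h0
    simp [this] at hb
  rw [eq_div_iff hb0, hr]
  push_cast
  rfl

end ReducesTo

theorem ascPochhammer_eval_ne_zero {F : Type*} [Field F] {x : F} (k : ℕ)
    (h : ∀ i < k, x + (i : F) ≠ 0) : (ascPochhammer F k).eval x ≠ 0 := by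
  induction k with
  | zero => simp
  | succ k ih =>
    rw [ascPochhammer_succ_eval]
    exact mul_ne_zero (ih fun i hi => h i (by omega)) (h k (by omega))

theorem ascPochhammer_eval_eq_zero {F : Type*} [Field F] {x : F} {k i : ℕ} (hi : i < k)
    (h : x + (i : F) = 0) : (ascPochhammer F k).eval x = 0 := by
  induction k with
  | zero => omega
  | succ k ih =>
    rw [ascPochhammer_succ_eval]
    rcases Nat.lt_succ_iff_lt_or_eq.1 hi with hi | rfl
    · rw [ih hi, zero_mul]
    · rw [h, mul_zero]

theorem derivative_ascPochhammer_eval {F : Type*} [Field F] {x : F} (k : ℕ)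
    (h : ∀ i < k, x + (i : F) ≠ 0) :
    (derivative (ascPochhammer F k)).eval x =
      (ascPochhammer F k).eval x * ∑ i ∈ Finset.range k, 1 / (x + (i : F)) := by
  induction k with
  | zero => simp
  | succ k ih =>
    have hk := h k (by omega)
    rw [ascPochhammer_succ_right, derivative_mul, Finset.sum_range_succ]
    simp only [eval_add, eval_mul, ih fun i hi => h i (by omega), derivative_add, derivative_X,
      derivative_natCast, eval_X, eval_natCast, eval_one, eval_zero]
    field_simp
    ring

theorem ascPochhammer_eval_mul_eval_add {F : Type*} [Field F] (x : F) (k m : ℕ) :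
    (ascPochhammer F k).eval x * (ascPochhammer F m).eval (x + k) =
      (ascPochhammer F (k + m)).eval x := by
  rw [← ascPochhammer_mul]
  simp

/-- A polynomial of degree less than `p - 1` sums to zero over `ZMod p`. -/
theorem sum_range_eval_eq_zero_of_natDegree_lt {p : ℕ} [Fact p.Prime] (f : (ZMod p)[X])
    (hf : f.natDegree < p - 1) : ∑ k ∈ Finset.range p, f.eval (k : ZMod p) = 0 := by
  have hsum : ∑ k ∈ Finset.range p, f.eval (k : ZMod p) = ∑ x : ZMod p, f.eval x := by
    refine Finset.sum_nbij' (fun k => (k : ZMod p)) ZMod.val (by simp) ?_ ?_ ?_ (by simp)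
    · intro x _
      simpa using ZMod.val_lt x
    · intro k hk
      exact ZMod.val_cast_of_lt (Finset.mem_range.1 hk)
    · intro x _
      simp
  rw [hsum]
  simp only [eval_eq_sum_range]
  rw [Finset.sum_comm]
  refine Finset.sum_eq_zero fun i hi => ?_
  rw [← Finset.mul_sum, FiniteField.sum_pow_lt_card_sub_one, mul_zero]
  rw [ZMod.card]
  have := Finset.mem_range.1 hi
  omega

theorem natCast_ne_zero_of_lt_prime {p j : ℕ} (h0 : 0 < j) (hj : j < p) :
    (j : ZMod p) ≠ 0 := by
  rw [Ne, ZMod.natCast_eq_zero_iff]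
  exact Nat.not_dvd_of_pos_of_lt h0 hj

theorem sum_range_inv_succ_add_sub {F : Type*} [Field F] (m k : ℕ) :
    (∑ i ∈ Finset.range k, 1 / ((m : F) + 1 + i)) - ∑ j ∈ Finset.range k, 1 / ((j : F) + 1) =
      (∑ j ∈ Finset.range m, 1 / ((k : F) + 1 + j)) - ∑ j ∈ Finset.range m, 1 / ((j : F) + 1) := by
  have h₁ := Finset.sum_range_add (fun j : ℕ => 1 / ((j : F) + 1)) m k
  have h₂ := Finset.sum_range_add (fun j : ℕ => 1 / ((j : F) + 1)) k m
  rw [add_comm k m, h₁] at h₂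
  simp only [Nat.cast_add, add_right_comm _ _ (1 : F)] at h₂
  linear_combination h₂

/-- The sum of `((m + 1)_k / (1)_k) ^ n * (∑_{i<k} 1/(m+1+i) - H_k) ^ 2` vanishes modulo `p`. -/
theorem sum_ascPochhammer_pow_mul_sq_eq_zero {p : ℕ} [Fact p.Prime] {n m : ℕ} (hn : 2 < n)
    (hp : m * n + 1 < p) :
    ∑ k ∈ Finset.range (p - m),
      (((ascPochhammer (ZMod p) k).eval ((m : ZMod p) + 1)) ^ n /
          ((ascPochhammer (ZMod p) k).eval 1) ^ n) *
        ((∑ i ∈ Finset.range k, 1 / ((m : ZMod p) + 1 + i)) -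
          ∑ j ∈ Finset.range k, 1 / ((j : ZMod p) + 1)) ^ 2 = 0 := by
  obtain ⟨d, rfl⟩ : ∃ d, n = d + 3 := ⟨n - 3, by omega⟩
  have hmp : m < p := by nlinarith
  have hone (k : ℕ) (hk : k < p) : (ascPochhammer (ZMod p) k).eval 1 ≠ 0 := by
    refine ascPochhammer_eval_ne_zero k fun i hi => ?_
    exact_mod_cast natCast_ne_zero_of_lt_prime (p := p) (j := 1 + i) (by omega) (by omega)
  set u : ZMod p := (ascPochhammer (ZMod p) m).eval 1 with hu
  set h : ZMod p := ∑ j ∈ Finset.range m, 1 / ((j : ZMod p) + 1) with hh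
  let P : (ZMod p)[X] := C u⁻¹ * ascPochhammer (ZMod p) m
  let f : (ZMod p)[X] := (P ^ (d + 1) * (derivative P - C h * P) ^ 2).comp (X + 1)
  have hP : P.natDegree ≤ m := (natDegree_C_mul_le _ _).trans (ascPochhammer_natDegree _ m).le
  have hf : f.natDegree < p - 1 := by
    have h₁ : (derivative P - C h * P).natDegree ≤ m :=
      (natDegree_sub_le _ _).trans (max_le
        ((natDegree_derivative_le P).trans ((Nat.sub_le _ _).trans hP))
        ((natDegree_C_mul_le _ _).trans hP))
    have h₂ : (P ^ (d + 1) * (derivative P - C h * P) ^ 2).natDegree ≤ (d + 1) * m + 2 * m :=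
      natDegree_mul_le_of_le (natDegree_pow_le_of_le _ hP) (natDegree_pow_le_of_le _ h₁)
    have h₃ : (X + 1 : (ZMod p)[X]).natDegree = 1 := by
      simpa using natDegree_X_add_C (1 : ZMod p)
    have h₄ : f.natDegree ≤ (d + 1) * m + 2 * m := by
      refine natDegree_comp_le.trans ?_
      rwa [h₃, mul_one]
    have h₅ : m * (d + 3) = (d + 1) * m + 2 * m := by ring
    omega
  rw [← sum_range_eval_eq_zero_of_natDegree_lt f hf]
  rw [← Finset.sum_subset (Finset.range_mono (Nat.sub_le p m))]
  · refine Finset.sum_congr rfl fun k hk => ?_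
    have hk := Finset.mem_range.1 hk
    have hk1 := hone k (by omega)
    have hu0 : u ≠ 0 := hone m hmp
    have hquot : (ascPochhammer (ZMod p) k).eval ((m : ZMod p) + 1) /
        (ascPochhammer (ZMod p) k).eval 1 =
          u⁻¹ * (ascPochhammer (ZMod p) m).eval ((k : ZMod p) + 1) := by
      have h₁ := ascPochhammer_eval_mul_eval_add (1 : ZMod p) m k
      have h₂ := ascPochhammer_eval_mul_eval_add (1 : ZMod p) k m
      rw [add_comm k m, ← h₁, add_comm (1 : ZMod p), add_comm (1 : ZMod p)] at h₂
      rw [← hu] at h₂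
      field_simp
      linear_combination -h₂
    have hder : (derivative (ascPochhammer (ZMod p) m)).eval ((k : ZMod p) + 1) =
        (ascPochhammer (ZMod p) m).eval ((k : ZMod p) + 1) *
          ∑ j ∈ Finset.range m, 1 / ((k : ZMod p) + 1 + j) := by
      refine derivative_ascPochhammer_eval m fun i hi => ?_
      exact_mod_cast natCast_ne_zero_of_lt_prime (p := p) (j := k + 1 + i) (by omega) (by omega)
    rw [← div_pow, hquot, sum_range_inv_succ_add_sub]
    simp only [f, P, eval_comp, eval_mul, eval_pow, eval_sub, eval_C, eval_add, eval_X, eval_one,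
      derivative_C_mul, hder]
    ring
  · intro k hk hk'
    simp only [Finset.mem_range, not_lt] at hk hk'
    have h0 : (ascPochhammer (ZMod p) m).eval ((k : ZMod p) + 1) = 0 := by
      refine ascPochhammer_eval_eq_zero (i := p - 1 - k) (by omega) ?_
      have : k + 1 + (p - 1 - k) = p := by omega
      exact_mod_cast (congrArg (Nat.cast : ℕ → ZMod p) this).trans (ZMod.natCast_self p)
    simp [f, P, h0]

/-- For integers `n > 2` and `q > 0` with `n` even or `q` odd, and any prime
`p > max {n, (q-1)n+1}`, the rational number
`∑_{k=0}^{p-q} ((q - p/n)_k^n / (1)_k^n) (∑_{i=0}^{k-1} 1/(q+i-p/n) - H_k^{(1)})^2`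
is congruent to `0` modulo `p`, i.e. it can be written as `p * a / b` with `p ∤ b`. -/
theorem stmt_13 (n q : ℕ) (hn : 2 < n) (hq : 0 < q) (hpar : Even n ∨ Odd q)
    (p : ℕ) (hp : p.Prime) (hgt : p > max n ((q - 1) * n + 1)) :
    ∃ a b : ℤ, ¬ ((p : ℤ) ∣ b) ∧
      ∑ k ∈ Finset.range (p - q + 1),
          (((ascPochhammer ℚ k).eval ((q : ℚ) - (p : ℚ) / (n : ℚ))) ^ n /
              ((ascPochhammer ℚ k).eval 1) ^ n) *
            ((∑ i ∈ Finset.range k, 1 / ((q : ℚ) + (i : ℚ) - (p : ℚ) / (n : ℚ))) - harm 1 k) ^ 2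
        = (p : ℚ) * a / b := by
  obtain ⟨m, rfl⟩ : ∃ m, q = m + 1 := ⟨q - 1, by omega⟩
  have := Fact.mk hp
  obtain ⟨hnp, hmp⟩ := max_lt_iff.1 hgt
  rw [Nat.add_sub_cancel] at hmp
  have hmp' : m + 1 < p := by nlinarith
  apply ReducesTo.exists_eq_mul_div
  have hα : ReducesTo p (((m + 1 : ℕ) : ℚ) - (p : ℚ) / (n : ℚ)) ((m : ZMod p) + 1) := by
    simpa using (ReducesTo.natCast (p := p) (m + 1)).sub
      ((ReducesTo.natCast p).div (ReducesTo.natCast n)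
        (natCast_ne_zero_of_lt_prime (by omega) hnp))
  have hone : ReducesTo p 1 1 := by simpa using ReducesTo.natCast (p := p) 1
  rw [← sum_ascPochhammer_pow_mul_sq_eq_zero hn hmp, show p - (m + 1) + 1 = p - m by omega]
  refine ReducesTo.sum_range _ fun k hk => ?_
  refine (((hα.ascPochhammer_eval k).pow n).div ((hone.ascPochhammer_eval k).pow n) ?_).mul
    (ReducesTo.pow (.sub (.sum_range k fun i hi => ?_) (.sum_range k fun j hj => ?_)) 2)
  · refine pow_ne_zero n (ascPochhammer_eval_ne_zero k fun i hi => ?_)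
    exact_mod_cast natCast_ne_zero_of_lt_prime (p := p) (j := 1 + i) (by omega) (by omega)
  · rw [add_sub_right_comm]
    refine hone.div (hα.add (.natCast i)) ?_
    exact_mod_cast natCast_ne_zero_of_lt_prime (p := p) (j := m + 1 + i) (by omega) (by omega)
  · rw [pow_one]
    refine hone.div ((ReducesTo.natCast j).add hone) ?_
    exact_mod_cast natCast_ne_zero_of_lt_prime (p := p) (j := j + 1) (by omega) (by omega)
end

section
/- Let n > 2 and q > 0 be integers and let p be a prime with p > (q-1)n + 1. Then the exact identity ∑_{k=0}^{p-q} (q-p)_k (q)_k^{n-1} / (1)_k^n = 0 holds in the rational numbers. -/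
/-- The alternating binomial sum of order `N` annihilates polynomials of degree less than `N`. -/
theorem Polynomial.sum_neg_one_pow_mul_choose_mul_eval_eq_zero {R : Type*} [CommRing R]
    {P : Polynomial R} {N : ℕ} (hP : P.natDegree < N) :
    ∑ k ∈ Finset.range (N + 1), (-1) ^ k * (N.choose k : R) * P.eval (k : R) = 0 := by
  have h := congrFun (Polynomial.fwdDiff_iter_eq_zero_of_degree_lt hP) 0
  rw [fwdDiff_iter_eq_sum_shift] at h
  have h' := congrArg ((-1) ^ N * ·) h
  simp only [Pi.zero_apply, mul_zero, Finset.mul_sum] at h'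
  rw [← h']
  refine Finset.sum_congr rfl fun k hk => ?_
  have hkN : k ≤ N := Nat.lt_succ_iff.mp (Finset.mem_range.mp hk)
  obtain ⟨d, rfl⟩ := Nat.exists_eq_add_of_le hkN
  have hd : ((-1 : R) ^ d) * (-1) ^ d = 1 := by rw [← mul_pow]; simp
  simp only [Nat.add_sub_cancel_left, zsmul_eq_mul, nsmul_eq_mul, zero_add, mul_one, pow_add]
  push_cast
  linear_combination (-(-1) ^ k * ((k + d).choose k : R) * P.eval (k : R)) * hd

theorem ascPochhammer_eval_neg_natCast {R : Type*} [CommRing R] (N k : ℕ) :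
    (ascPochhammer R k).eval (-(N : R)) = (-1) ^ k * (k.factorial * N.choose k) := by
  rw [ascPochhammer_eval_neg_eq_descPochhammer, descPochhammer_eval_eq_descFactorial,
    Nat.descFactorial_eq_factorial_mul_choose, Nat.cast_mul]

/-- `(m + 1)_k / k! = (k + 1)_m / m!`, in cross-multiplied form. -/
theorem factorial_mul_ascPochhammer_comm (R : Type*) [Semiring R] (m k : ℕ) :
    (m.factorial : R) * (ascPochhammer R k).eval ((m : R) + 1) =
      k.factorial * (ascPochhammer R m).eval ((k : R) + 1) := by
  rw [factorial_mul_ascPochhammer, factorial_mul_ascPochhammer, add_comm]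

/-- Let `n > 2`, `q > 0` be integers and `p` a prime with `p > (q-1)n + 1`.
Then `∑_{k=0}^{p-q} (q-p)_k (q)_k^{n-1} / (1)_k^n = 0` holds exactly in `ℚ`. -/
theorem stmt_14 (n q : ℕ) (hn : 2 < n) (hq : 0 < q)
    (p : ℕ) (hp : p.Prime) (hgt : p > (q - 1) * n + 1) :
    ∑ k ∈ Finset.range (p - q + 1),
        ((ascPochhammer ℚ k).eval ((q : ℚ) - (p : ℚ)) *
            ((ascPochhammer ℚ k).eval (q : ℚ)) ^ (n - 1)) /
          ((ascPochhammer ℚ k).eval 1) ^ n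
      = 0 := by
  obtain ⟨m, rfl⟩ := Nat.exists_eq_add_of_le' hq
  obtain ⟨j, rfl⟩ := Nat.exists_eq_add_of_lt (Nat.zero_lt_of_lt hn)
  simp only [Nat.add_sub_cancel, zero_add, mul_add, mul_one] at hgt ⊢
  obtain ⟨N, rfl⟩ := Nat.exists_eq_add_of_le (show m + 1 ≤ p by omega)
  rw [Nat.add_sub_cancel_left]
  set P : Polynomial ℚ := ((ascPochhammer ℚ m).comp (.X + .C 1)) ^ j with hPdef
  have hP : P.natDegree < N := by
    rw [hPdef, Polynomial.natDegree_pow, Polynomial.natDegree_comp, ascPochhammer_natDegree,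
      Polynomial.natDegree_X_add_C, mul_one, mul_comm]
    omega
  have key := Polynomial.sum_neg_one_pow_mul_choose_mul_eval_eq_zero hP
  have key' := congrArg (((m.factorial : ℚ) ^ j)⁻¹ * ·) key
  simp only [mul_zero, Finset.mul_sum] at key'
  rw [← key']
  refine Finset.sum_congr rfl fun k _ => ?_
  have hk : (k.factorial : ℚ) ≠ 0 := by positivity
  have hm : (m.factorial : ℚ) ≠ 0 := by positivity
  have hneg : ((m + 1 : ℕ) : ℚ) - ((m + 1 + N : ℕ) : ℚ) = -(N : ℚ) := by push_cast; ring
  have hsymm : (ascPochhammer ℚ k).eval ((m : ℚ) + 1) =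
      k.factorial * (ascPochhammer ℚ m).eval ((k : ℚ) + 1) / m.factorial := by
    rw [eq_div_iff hm, mul_comm, factorial_mul_ascPochhammer_comm]
  rw [hneg, ascPochhammer_eval_neg_natCast, ascPochhammer_eval_one, Nat.cast_succ, hsymm]
  simp only [hPdef, Polynomial.eval_pow, Polynomial.eval_comp, Polynomial.eval_add,
    Polynomial.eval_X, Polynomial.eval_C, div_pow, mul_pow, pow_succ]
  field_simp
end

section
/- Let n > 2 and q > 0 be integers such that n is even or q is odd, and let p be a prime with p > max{n, (q-1)n + 1}. Then ∑_{k=0}^{p-1} (q - p/n)_k^n / (1)_k^n ≡ ((n-1)/(2n)) · p^2 · ∑_{k=0}^{p-q} ((q)_k^n / (1)_k^n) · ∑_{i=0}^{k-1} 1/(q+i)^2 (mod p^3), i.e., the p-adic valuation of the difference of the two sides is at least 3. -/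
open Polynomial Finset

/-- The rational numbers whose denominator is prime to `p`. -/
def pIntegral (p : ℕ) (hp : p.Prime) : Subring ℚ where
  carrier := {r | ∃ a b : ℤ, ¬ (p : ℤ) ∣ b ∧ r = a / b}
  zero_mem' := ⟨0, 1, mod_cast hp.not_dvd_one, by simp⟩
  one_mem' := ⟨1, 1, mod_cast hp.not_dvd_one, by simp⟩
  add_mem' := by
    rintro _ _ ⟨a, b, hb, rfl⟩ ⟨c, d, hd, rfl⟩
    have hb0 : (b : ℚ) ≠ 0 := by rintro h; exact hb (by simp_all)
    have hd0 : (d : ℚ) ≠ 0 := by rintro h; exact hd (by simp_all)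
    refine ⟨a * d + b * c, b * d, (Nat.prime_iff_prime_int.1 hp).not_dvd_mul hb hd, ?_⟩
    push_cast
    field_simp
  mul_mem' := by
    rintro _ _ ⟨a, b, hb, rfl⟩ ⟨c, d, hd, rfl⟩
    refine ⟨a * c, b * d, (Nat.prime_iff_prime_int.1 hp).not_dvd_mul hb hd, ?_⟩
    push_cast
    exact div_mul_div_comm _ _ _ _
  neg_mem' := by
    rintro _ ⟨a, b, hb, rfl⟩
    exact ⟨-a, b, hb, by push_cast; ring⟩

lemma inv_natCast_mem_pIntegral {p : ℕ} (hp : p.Prime) {m : ℕ} (hm : ¬ p ∣ m) :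
    (m : ℚ)⁻¹ ∈ pIntegral p hp :=
  ⟨1, m, mod_cast hm, by simp⟩

lemma exists_one_sub_pow_eq {R : Type*} [CommRing R] (y : R) (n : ℕ) :
    ∃ z, (1 - y) ^ n = 1 - n * y + n.choose 2 * y ^ 2 + y ^ 3 * z := by
  induction n with
  | zero => exact ⟨0, by simp⟩
  | succ n ih =>
    obtain ⟨z, h⟩ := ih
    refine ⟨z - n.choose 2 - y * z, ?_⟩
    rw [pow_succ, h, Nat.choose_succ_succ' n 1, Nat.choose_one_right]
    push_cast
    ring

lemma exists_prod_one_sub_eq {R : Type*} [CommRing R] (π : R) (u : ℕ → R) (k : ℕ) :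
    ∃ w, ∏ i ∈ range k, (1 - π * u i) = 1 + π * w := by
  induction k with
  | zero => exact ⟨0, by simp⟩
  | succ k ih =>
    obtain ⟨w, h⟩ := ih
    refine ⟨w - u k - π * w * u k, ?_⟩
    rw [prod_range_succ, h]
    ring

/-- Two products whose first-order terms in `π` agree, compared modulo `π ^ 3`. -/
lemma exists_prod_one_sub_pow_eq {R : Type*} [CommRing R] (π c : R) {n : ℕ} (hnc : n * c = 1)
    (u : ℕ → R) (k : ℕ) :
    ∃ z, ∏ i ∈ range k, (1 - c * π * u i) ^ n =
      ∏ i ∈ range k, (1 - π * u i) +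
        n.choose 2 * c ^ 2 * π ^ 2 * ∑ i ∈ range k, u i ^ 2 + π ^ 3 * z := by
  induction k with
  | zero => exact ⟨0, by simp⟩
  | succ k ih =>
    obtain ⟨z, h⟩ := ih
    obtain ⟨w, hw⟩ := exists_prod_one_sub_eq π u k
    obtain ⟨y, hy⟩ := exists_one_sub_pow_eq (c * π * u k) n
    have hfac : (1 - c * π * u k) ^ n =
        1 - π * u k + n.choose 2 * c ^ 2 * π ^ 2 * u k ^ 2 + π ^ 3 * (c ^ 3 * u k ^ 3 * y) := by
      rw [hy]
      linear_combination (-π * u k) * hnc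
    rw [prod_range_succ, prod_range_succ, sum_range_succ, h, hfac]
    generalize ∑ i ∈ range k, u i ^ 2 = s
    generalize (n.choose 2 : R) = d
    generalize ∏ i ∈ range k, (1 - π * u i) = B at hw
    refine ⟨w * (d * c ^ 2 * u k ^ 2) + B * (c ^ 3 * u k ^ 3 * y) - d * c ^ 2 * s * u k +
      d * c ^ 2 * s * (π * (d * c ^ 2 * u k ^ 2)) +
      d * c ^ 2 * s * (π ^ 2 * (c ^ 3 * u k ^ 3 * y)) +
      z * (1 - π * u k + d * c ^ 2 * π ^ 2 * u k ^ 2 + π ^ 3 * (c ^ 3 * u k ^ 3 * y)), ?_⟩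
    linear_combination (d * c ^ 2 * π ^ 2 * u k ^ 2) * hw

lemma ascPochhammer_eval_mem {K : Type*} [CommRing K] (S : Subring K) {x : K} (hx : x ∈ S)
    (k : ℕ) : (ascPochhammer K k).eval x ∈ S := by
  induction k with
  | zero => simp
  | succ k ih =>
    rw [ascPochhammer_succ_eval]
    exact S.mul_mem ih (S.add_mem hx (natCast_mem S k))

lemma ascPochhammer_eval_sub {K : Type*} [Field K] (x y : K) (k : ℕ)
    (hx : ∀ i < k, x + (i : ℕ) ≠ 0) :
    (ascPochhammer K k).eval (x - y) =
      (ascPochhammer K k).eval x * ∏ i ∈ range k, (1 - y * (x + (i : ℕ))⁻¹) := by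
  induction k with
  | zero => simp
  | succ k ih =>
    have := hx k (by lia)
    rw [ascPochhammer_succ_eval, ascPochhammer_succ_eval, ih fun i hi => hx i (by lia),
      prod_range_succ]
    field_simp
    ring

/-- The `n`-th power of a shifted Pochhammer symbol, expanded modulo `π ^ 3`. -/
lemma exists_ascPochhammer_eval_sub_pow_eq {K : Type*} [Field K] (S : Subring K) {x π c : K}
    (hx : x ∈ S) (hπ : π ∈ S) (hc : c ∈ S) {n : ℕ} (hnc : (n + 1 : ℕ) * c = 1) (k : ℕ)
    (hx0 : ∀ i < k, x + (i : ℕ) ≠ 0) (hinv : ∀ i < k, (x + (i : ℕ))⁻¹ ∈ S) :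
    ∃ z ∈ S, (ascPochhammer K k).eval (x - c * π) ^ (n + 1) =
      (ascPochhammer K k).eval (x - π) * (ascPochhammer K k).eval x ^ n +
        (n + 1).choose 2 * c ^ 2 * π ^ 2 * ((ascPochhammer K k).eval x ^ (n + 1) *
          ∑ i ∈ range k, 1 / (x + (i : ℕ)) ^ 2) + π ^ 3 * z := by
  classical
  let u : ℕ → S := fun i => if h : (x + (i : ℕ))⁻¹ ∈ S then ⟨_, h⟩ else 0
  have hu : ∀ i ∈ range k, (u i : K) = (x + (i : ℕ))⁻¹ := fun i hi => by
    simp [u, hinv i (mem_range.1 hi)]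
  obtain ⟨z, hz⟩ := exists_prod_one_sub_pow_eq (⟨π, hπ⟩ : S) ⟨c, hc⟩ (n := n + 1)
    (Subtype.ext (by simpa using hnc)) u k
  have hz' := congrArg (S.subtype) hz
  simp only [map_prod, map_add, map_mul, map_pow, map_sub, map_one, map_sum, map_natCast,
    Subring.subtype_apply] at hz'
  have hprod (y : K) : ∏ i ∈ range k, (1 - y * u i) =
      ∏ i ∈ range k, (1 - y * (x + (i : ℕ))⁻¹) :=
    prod_congr rfl fun i hi => by rw [hu i hi]
  rw [prod_pow, hprod, hprod, sum_congr rfl fun i hi => by rw [hu i hi]] at hz'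
  refine ⟨(ascPochhammer K k).eval x ^ (n + 1) * z,
    S.mul_mem (S.pow_mem (ascPochhammer_eval_mem S hx k) _) z.2, ?_⟩
  rw [ascPochhammer_eval_sub x _ k hx0, ascPochhammer_eval_sub x _ k hx0, mul_pow, hz']
  simp only [one_div, inv_pow]
  ring

/-- A Karlsson–Minton type vanishing sum: it is an `N`-th finite difference of a polynomial of
degree `r * m < N`. -/
lemma sum_ascPochhammer_neg_mul_pow_eq_zero (N r m : ℕ) (h : r * m < N) :
    ∑ k ∈ range (N + 1), (ascPochhammer ℚ k).eval (-(N : ℚ)) *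
      (ascPochhammer ℚ k).eval ((r : ℚ) + 1) ^ m / (k.factorial : ℚ) ^ (m + 1) = 0 := by
  have hdeg : (preHilbertPoly ℚ r 0 ^ m).natDegree < N := by
    rw [natDegree_pow, natDegree_preHilbertPoly]
    lia
  have key := congrFun (fwdDiff_iter_eq_zero_of_degree_lt hdeg) 0
  rw [fwdDiff_iter_eq_sum_shift] at key
  have hN : ((-1 : ℚ)) ^ N ≠ 0 := pow_ne_zero _ (by norm_num)
  refine (mul_eq_zero_iff_left hN).1 ?_
  rw [Pi.zero_apply] at key
  rw [← key, mul_sum]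
  refine sum_congr rfl fun k hk => ?_
  have hkN : k ≤ N := by have := mem_range.1 hk; lia
  have h1 : (ascPochhammer ℚ k).eval (-(N : ℚ)) = (-1) ^ k * (k.factorial * N.choose k) := by
    rw [ascPochhammer_eval_neg_eq_descPochhammer, descPochhammer_eval_eq_descFactorial,
      Nat.descFactorial_eq_factorial_mul_choose]
    push_cast; ring
  have h2 : (ascPochhammer ℚ k).eval ((r : ℚ) + 1) =
      k.factorial * (preHilbertPoly ℚ r 0).eval (k : ℚ) := by
    rw [preHilbertPoly_eq_choose_sub_add ℚ r (Nat.zero_le k), ← Nat.cast_succ,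
      ascPochhammer_nat_eq_natCast_ascFactorial,
      Nat.ascFactorial_eq_factorial_mul_choose, Nat.sub_zero, add_comm k r,
      Nat.choose_symm_add]
    push_cast; ring
  have hs : (-1 : ℚ) ^ N * (-1) ^ k = (-1) ^ (N - k) := by
    obtain ⟨j, rfl⟩ := Nat.exists_eq_add_of_le hkN
    rw [Nat.add_sub_cancel_left, pow_add, mul_right_comm, ← mul_pow]
    simp
  have hk0 : (k.factorial : ℚ) ≠ 0 := mod_cast k.factorial_ne_zero
  rw [h1, h2, zsmul_eq_mul]
  push_cast
  rw [← hs]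
  simp only [nsmul_eq_mul, mul_one, zero_add, eval_pow]
  field_simp
  ring

lemma exists_ascPochhammer_eval_eq_mul {K : Type*} [CommRing K] (S : Subring K) {x π : K}
    (hx : x ∈ S) {j k : ℕ} (hjk : j < k) (hj : ∃ y ∈ S, x + (j : ℕ) = π * y) :
    ∃ z ∈ S, (ascPochhammer K k).eval x = π * z := by
  induction k, hjk using Nat.le_induction with
  | base =>
    obtain ⟨y, hy, h⟩ := hj
    refine ⟨(ascPochhammer K j).eval x * y, S.mul_mem (ascPochhammer_eval_mem S hx j) hy, ?_⟩
    rw [ascPochhammer_succ_eval, h]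
    ring
  | succ k _ ih =>
    obtain ⟨z, hz, h⟩ := ih
    refine ⟨z * (x + (k : ℕ)), S.mul_mem hz (S.add_mem hx (natCast_mem S k)), ?_⟩
    rw [ascPochhammer_succ_eval, h]
    ring

/-- For integers `n > 2` and `q > 0` with `n` even or `q` odd, and any prime
`p > max {n, (q-1)n+1}`,
`∑_{k=0}^{p-1} (q - p/n)_k^n / (1)_k^n ≡
  ((n-1)/(2n)) p^2 ∑_{k=0}^{p-q} ((q)_k^n / (1)_k^n) ∑_{i=0}^{k-1} 1/(q+i)^2 (mod p^3)`,
i.e. the difference of the two sides can be written as `p^3 * a / b` with `p ∤ b`. -/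
theorem stmt_18 (n q : ℕ) (hn : 2 < n) (hq : 0 < q) (hpar : Even n ∨ Odd q)
    (p : ℕ) (hp : p.Prime) (hgt : p > max n ((q - 1) * n + 1)) :
    ∃ a b : ℤ, ¬ ((p : ℤ) ∣ b) ∧
      (∑ k ∈ Finset.range p,
          ((ascPochhammer ℚ k).eval ((q : ℚ) - (p : ℚ) / (n : ℚ))) ^ n /
            ((ascPochhammer ℚ k).eval 1) ^ n)
        - ((n : ℚ) - 1) / (2 * (n : ℚ)) * (p : ℚ) ^ 2 *
          ∑ k ∈ Finset.range (p - q + 1),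
            (((ascPochhammer ℚ k).eval (q : ℚ)) ^ n / ((ascPochhammer ℚ k).eval 1) ^ n) *
              ∑ i ∈ Finset.range k, 1 / ((q : ℚ) + (i : ℚ)) ^ 2
        = (p : ℚ) ^ 3 * a / b := by
  obtain ⟨hnp, hqp⟩ := max_lt_iff.1 hgt
  obtain ⟨r, rfl⟩ := Nat.exists_eq_add_of_lt hq
  obtain ⟨m, rfl⟩ : ∃ m, n = m + 1 := ⟨n - 1, by lia⟩
  simp only [zero_add, Nat.add_sub_cancel] at *
  obtain ⟨N, rfl⟩ : ∃ N, p = N + (r + 1) :=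
    ⟨p - (r + 1), (Nat.sub_add_cancel (by nlinarith)).symm⟩
  have hrm : r * m < N := by nlinarith
  rw [Nat.add_sub_cancel]
  set p := N + (r + 1) with hpN
  set S := pIntegral p hp
  set c : ℚ := ((m + 1 : ℕ) : ℚ)⁻¹ with hc_def
  have hm0 : ((m + 1 : ℕ) : ℚ) ≠ 0 := by positivity
  have hnc : ((m + 1 : ℕ) : ℚ) * c = 1 := mul_inv_cancel₀ hm0
  have hc : c ∈ S :=
    inv_natCast_mem_pIntegral hp (Nat.not_dvd_of_pos_of_lt (by lia) hnp)
  have hq_mem : ((r + 1 : ℕ) : ℚ) ∈ S := natCast_mem S _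
  have hp_mem : (p : ℚ) ∈ S := natCast_mem S _
  have hd : ((m + 1 : ℕ) - 1 : ℚ) / (2 * (m + 1 : ℕ)) = (m + 1).choose 2 * c ^ 2 := by
    rw [Nat.cast_choose_two, hc_def]
    field_simp
  have hfac : ∀ k < p, ((k.factorial : ℚ) ^ (m + 1))⁻¹ ∈ S := fun k hk => by
    rw [← Nat.cast_pow]
    refine inv_natCast_mem_pIntegral hp fun h => ?_
    exact absurd ((hp.dvd_factorial).1 (hp.dvd_of_dvd_pow h)) (by lia)
  have hxc : ((r + 1 : ℕ) : ℚ) - p / (m + 1 : ℕ) = (r + 1 : ℕ) - c * p := by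
    rw [hc_def, div_eq_inv_mul]
  have hneg : ((r + 1 : ℕ) : ℚ) - p = -(N : ℚ) := by
    rw [hpN]; push_cast; ring
  have hxc_mem : ((r + 1 : ℕ) : ℚ) - c * p ∈ S := S.sub_mem hq_mem (S.mul_mem hc hp_mem)
  have hlow : ∀ k ∈ range (N + 1), ∃ z ∈ S,
      (ascPochhammer ℚ k).eval ((r + 1 : ℕ) - c * p : ℚ) ^ (m + 1) /
          (k.factorial : ℚ) ^ (m + 1) =
        (ascPochhammer ℚ k).eval (-(N : ℚ)) * (ascPochhammer ℚ k).eval ((r : ℚ) + 1) ^ m /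
          (k.factorial : ℚ) ^ (m + 1) +
        (m + 1).choose 2 * c ^ 2 * p ^ 2 *
          ((ascPochhammer ℚ k).eval ((r + 1 : ℕ) : ℚ) ^ (m + 1) / (k.factorial : ℚ) ^ (m + 1) *
            ∑ i ∈ range k, 1 / (((r + 1 : ℕ) : ℚ) + i) ^ 2) + p ^ 3 * z := by
    intro k hk
    have hk := mem_range.1 hk
    obtain ⟨z, hz, h⟩ := exists_ascPochhammer_eval_sub_pow_eq S hq_mem hp_mem hc hnc k
      (fun i _ => by positivity) fun i hi => by
        rw [← Nat.cast_add]
        exact inv_natCast_mem_pIntegral hp (Nat.not_dvd_of_pos_of_lt (by lia) (by lia))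
    refine ⟨z * ((k.factorial : ℚ) ^ (m + 1))⁻¹, S.mul_mem hz (hfac k (by lia)), ?_⟩
    rw [h, hneg, Nat.cast_succ r]
    ring
  have hhigh : ∀ k ∈ range r, ∃ z ∈ S,
      (ascPochhammer ℚ (N + 1 + k)).eval ((r + 1 : ℕ) - c * p : ℚ) ^ (m + 1) /
          ((N + 1 + k).factorial : ℚ) ^ (m + 1) = p ^ 3 * z := by
    intro k hk
    have hk := mem_range.1 hk
    obtain ⟨z, hz, h⟩ := exists_ascPochhammer_eval_eq_mul S hxc_mem (π := (p : ℚ))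
      (show N < N + 1 + k by lia)
      ⟨1 - c, S.sub_mem S.one_mem hc, by rw [hpN]; push_cast; ring⟩
    obtain ⟨l, rfl⟩ : ∃ l, m = l + 2 := ⟨m - 2, by lia⟩
    refine ⟨p ^ l * z ^ (l + 2 + 1) * (((N + 1 + k).factorial : ℚ) ^ (l + 2 + 1))⁻¹,
      S.mul_mem (S.mul_mem (S.pow_mem hp_mem _) (S.pow_mem hz _)) (hfac _ (by lia)), ?_⟩
    rw [h]
    ring
  choose! z hzS hz using hlow
  choose! w hwS hw using hhigh
  obtain ⟨a, b, hb, hab⟩ : (∑ k ∈ range (N + 1), z k + ∑ k ∈ range r, w k) ∈ S :=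
    S.add_mem (S.sum_mem hzS) (S.sum_mem hwS)
  refine ⟨a, b, hb, ?_⟩
  rw [mul_div_assoc, ← hab, hd]
  simp only [hxc, ascPochhammer_eval_one]
  rw [show p = N + 1 + r by lia, sum_range_add, ← show p = N + 1 + r by lia,
    sum_congr rfl hz, sum_congr rfl hw, sum_add_distrib, sum_add_distrib,
    sum_ascPochhammer_neg_mul_pow_eq_zero N r m hrm, ← mul_sum, ← mul_sum, ← mul_sum]
  ring
end

section
/- Let n > 2 and q > 1 be integers such that n is even or q is odd, and let p be a prime with p > max{n, (q-1)n + 1}. Then the rational number ∑_{k=0}^{p-1} (q - p/n - p)_k^n / (1-p)_k^n is congruent to 0 modulo p^3, i.e., its p-adic valuation is at least 3. (Note that (1-p)_k ≠ 0 for 0 ≤ k ≤ p-1, so every summand is a well-defined rational number.) -/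
namespace PochhammerSum

open Finset Polynomial

section Congruence

variable (p : ℕ) [hp : Fact p.Prime]

/-- The localization of `ℤ` at `p`, as a subring of `ℚ`. -/
def localInt : Subring ℚ where
  carrier := {x | ∃ a b : ℤ, ¬ (p : ℤ) ∣ b ∧ x = a / b}
  one_mem' := ⟨1, 1, fun h => (Nat.prime_iff_prime_int.mp hp.out).not_isUnit
    (isUnit_of_dvd_one h), by norm_num⟩
  zero_mem' := ⟨0, 1, fun h => (Nat.prime_iff_prime_int.mp hp.out).not_isUnit
    (isUnit_of_dvd_one h), by norm_num⟩
  mul_mem' := by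
    rintro _ _ ⟨a, b, hb, rfl⟩ ⟨c, d, hd, rfl⟩
    refine ⟨a * c, b * d, (Nat.prime_iff_prime_int.mp hp.out).not_dvd_mul hb hd, ?_⟩
    push_cast
    rw [div_mul_div_comm]
  add_mem' := by
    rintro _ _ ⟨a, b, hb, rfl⟩ ⟨c, d, hd, rfl⟩
    refine ⟨a * d + b * c, b * d, (Nat.prime_iff_prime_int.mp hp.out).not_dvd_mul hb hd, ?_⟩
    have hb0 : (b : ℚ) ≠ 0 := by rintro h; simp_all
    have hd0 : (d : ℚ) ≠ 0 := by rintro h; simp_all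
    push_cast
    rw [div_add_div _ _ hb0 hd0]
  neg_mem' := by
    rintro _ ⟨a, b, hb, rfl⟩
    exact ⟨-a, b, hb, by push_cast; ring⟩

/-- The additive subgroup `p ^ m ℤ_(p)` of `ℚ`. -/
def powMultiples (m : ℕ) : AddSubgroup ℚ :=
  (localInt p).toAddSubgroup.map (AddMonoidHom.mulLeft ((p : ℚ) ^ m))

variable {p}

lemma cast_ne_zero : (p : ℚ) ≠ 0 := by exact_mod_cast hp.out.ne_zero

lemma mem_powMultiples {m : ℕ} {x : ℚ} :
    x ∈ powMultiples p m ↔ ∃ r ∈ localInt p, x = (p : ℚ) ^ m * r := by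
  constructor
  · rintro ⟨r, hr, rfl⟩
    exact ⟨r, hr, rfl⟩
  · rintro ⟨r, hr, rfl⟩
    exact ⟨r, hr, rfl⟩

lemma pow_mul_mem_powMultiples (m : ℕ) {x : ℚ} (hx : x ∈ localInt p) :
    (p : ℚ) ^ m * x ∈ powMultiples p m := mem_powMultiples.mpr ⟨x, hx, rfl⟩

lemma mul_mem_powMultiples {m : ℕ} {x y : ℚ} (hx : x ∈ powMultiples p m)
    (hy : y ∈ localInt p) : x * y ∈ powMultiples p m := by
  obtain ⟨r, hr, rfl⟩ := mem_powMultiples.mp hx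
  rw [mul_assoc]
  exact pow_mul_mem_powMultiples m (mul_mem hr hy)

lemma natCast_inv_mem {a : ℕ} (h0 : 0 < a) (h : a < p) : (a : ℚ)⁻¹ ∈ localInt p := by
  refine ⟨1, a, fun h1 => ?_, by push_cast; rw [one_div]⟩
  exact absurd (Nat.le_of_dvd h0 (Int.natCast_dvd_natCast.mp h1)) (by omega)

lemma one_add_mul_ne_zero_and_inv_mem {r : ℚ} (hr : r ∈ localInt p) :
    1 + p * r ≠ 0 ∧ (1 + p * r)⁻¹ ∈ localInt p := by
  obtain ⟨a, b, hb, rfl⟩ := hr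
  have hb0 : (b : ℚ) ≠ 0 := by rintro h; simp_all
  have hd : ¬ (p : ℤ) ∣ b + p * a := fun h => hb ((Int.dvd_add_left ⟨a, rfl⟩).mp h)
  have hd0 : (b : ℚ) + p * a ≠ 0 := by
    intro h
    have h' : b + p * a = 0 := by exact_mod_cast h
    exact hd (h' ▸ dvd_zero _)
  have e : 1 + (p : ℚ) * (a / b) = (b + p * a) / b := by field_simp
  rw [e]
  exact ⟨div_ne_zero hd0 hb0, b, b + p * a, hd, by push_cast; rw [inv_div]⟩

lemma one_add_mul_ne_zero {r : ℚ} (hr : r ∈ localInt p) : 1 + p * r ≠ 0 :=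
  (one_add_mul_ne_zero_and_inv_mem hr).1

lemma inv_one_add_mul_mem {r : ℚ} (hr : r ∈ localInt p) : (1 + p * r)⁻¹ ∈ localInt p :=
  (one_add_mul_ne_zero_and_inv_mem hr).2

variable (p) in
/-- `RelCongr p f g c` says that `f ≡ g (1 + p² c)` modulo `g p³ ℤ_(p)`. -/
def RelCongr (f g c : ℚ) : Prop :=
  ∃ r ∈ localInt p, f = g * (1 + (p : ℚ) ^ 2 * c + (p : ℚ) ^ 3 * r)

namespace RelCongr

lemma refl (f : ℚ) : RelCongr p f f 0 := ⟨0, zero_mem _, by ring⟩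

lemma trans {f g h c d : ℚ} (hc : c ∈ localInt p) (hd : d ∈ localInt p)
    (hfg : RelCongr p f g c) (hgh : RelCongr p g h d) : RelCongr p f h (c + d) := by
  obtain ⟨r, hr, rfl⟩ := hfg
  obtain ⟨t, ht, rfl⟩ := hgh
  refine ⟨r + t + p * (c * d) + p ^ 2 * (c * t + d * r) + p ^ 3 * (r * t), ?_, by ring⟩
  have hP : (p : ℚ) ∈ localInt p := natCast_mem _ _
  apply_rules [add_mem, mul_mem, pow_mem]

lemma mul {f g f' g' c d : ℚ} (hc : c ∈ localInt p) (hd : d ∈ localInt p)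
    (h : RelCongr p f g c) (h' : RelCongr p f' g' d) :
    RelCongr p (f * f') (g * g') (c + d) := by
  obtain ⟨r, hr, rfl⟩ := h
  obtain ⟨t, ht, rfl⟩ := h'
  refine ⟨r + t + p * (c * d) + p ^ 2 * (c * t + d * r) + p ^ 3 * (r * t), ?_, by ring⟩
  have hP : (p : ℚ) ∈ localInt p := natCast_mem _ _
  apply_rules [add_mem, mul_mem, pow_mem]

lemma prod {f g c : ℕ → ℚ} {l : ℕ} (hc : ∀ j < l, c j ∈ localInt p)
    (h : ∀ j < l, RelCongr p (f j) (g j) (c j)) :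
    RelCongr p (∏ j ∈ range l, f j) (∏ j ∈ range l, g j) (∑ j ∈ range l, c j) := by
  induction l with
  | zero => exact refl 1
  | succ l ih =>
    rw [prod_range_succ, prod_range_succ, sum_range_succ]
    exact mul (sum_mem fun j hj => hc j ((mem_range.mp hj).trans l.lt_succ_self))
      (hc l l.lt_succ_self) (ih (fun j hj => hc j (hj.trans l.lt_succ_self))
        fun j hj => h j (hj.trans l.lt_succ_self)) (h l l.lt_succ_self)

lemma exists_inv_eq {c r : ℚ} (hc : c ∈ localInt p) (hr : r ∈ localInt p) :
    1 + (p : ℚ) ^ 2 * c + (p : ℚ) ^ 3 * r ≠ 0 ∧ ∃ t ∈ localInt p,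
      (1 + (p : ℚ) ^ 2 * c + (p : ℚ) ^ 3 * r)⁻¹ = 1 + (p : ℚ) ^ 2 * (-c) + (p : ℚ) ^ 3 * t := by
  have hP : (p : ℚ) ∈ localInt p := natCast_mem _ _
  have e : 1 + (p : ℚ) ^ 2 * c + (p : ℚ) ^ 3 * r = 1 + p * (p * c + p ^ 2 * r) := by ring
  have hm : (p : ℚ) * c + p ^ 2 * r ∈ localInt p := by
    apply_rules [add_mem, mul_mem, pow_mem]
  have h0 := one_add_mul_ne_zero hm
  have hi := inv_one_add_mul_mem hm
  rw [← e] at h0 hi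
  refine ⟨h0, (1 + (p : ℚ) ^ 2 * c + (p : ℚ) ^ 3 * r)⁻¹ * (p * c ^ 2 - r + p ^ 2 * (r * c)), ?_, ?_⟩
  · apply_rules [mul_mem, add_mem, sub_mem, pow_mem]
  · field_simp
    ring

lemma symm {f g c : ℚ} (hc : c ∈ localInt p) (h : RelCongr p f g c) : RelCongr p g f (-c) := by
  obtain ⟨r, hr, rfl⟩ := h
  obtain ⟨h0, t, ht, e⟩ := exists_inv_eq hc hr
  exact ⟨t, ht, by rw [← e, mul_assoc, mul_inv_cancel₀ h0, mul_one]⟩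

lemma inv {f g c : ℚ} (hc : c ∈ localInt p) (h : RelCongr p f g c) :
    RelCongr p f⁻¹ g⁻¹ (-c) := by
  obtain ⟨r, hr, rfl⟩ := h
  obtain ⟨-, t, ht, e⟩ := exists_inv_eq hc hr
  exact ⟨t, ht, by rw [← e, mul_inv]⟩

lemma div {f g f' g' c d : ℚ} (hc : c ∈ localInt p) (hd : d ∈ localInt p)
    (h : RelCongr p f g c) (h' : RelCongr p f' g' d) :
    RelCongr p (f / f') (g / g') (c - d) := by
  rw [div_eq_mul_inv, div_eq_mul_inv, sub_eq_add_neg]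
  exact mul hc (neg_mem hd) h (inv hd h')

lemma one_add_mul_one_add {w v : ℚ} (hw : w ∈ localInt p) (hv : v ∈ localInt p) :
    RelCongr p ((1 + p * w) * (1 + p * v)) (1 + p * (w + v)) (w * v) := by
  have hm := add_mem hw hv
  have h0 := one_add_mul_ne_zero hm
  refine ⟨(1 + p * (w + v))⁻¹ * (-(w + v) * w * v), ?_, ?_⟩
  · have := inv_one_add_mul_mem hm
    apply_rules [mul_mem, neg_mem]
  · field_simp
    ring

lemma one_add_pow {z : ℚ} (hz : z ∈ localInt p) (n : ℕ) :
    RelCongr p ((1 + p * z) ^ n) (1 + p * (n * z)) (n.choose 2 * z ^ 2) := by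
  induction n with
  | zero => simpa using refl (p := p) 1
  | succ n ih =>
    have h1 := mul (by apply_rules [mul_mem, pow_mem, natCast_mem]) (zero_mem _) ih
      (refl (1 + p * z))
    have h2 := one_add_mul_one_add (mul_mem (natCast_mem (localInt p) n) hz) hz
    have h3 := trans (by apply_rules [add_mem, mul_mem, pow_mem, natCast_mem, zero_mem])
      (by apply_rules [mul_mem, natCast_mem]) h1 h2
    rw [pow_succ]
    convert h3 using 1
    · push_cast; ring
    · rw [Nat.choose_succ_succ' n 1]
      push_cast [Nat.choose_one_right]; ring

lemma const_mul (a : ℚ) {f g c : ℚ} (h : RelCongr p f g c) : RelCongr p (a * f) (a * g) c := by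
  obtain ⟨r, hr, rfl⟩ := h
  exact ⟨r, hr, by ring⟩

end RelCongr

end Congruence

section Vanishing

/-- The quotient `(s + 1 + y)_l / (1 + y)_l`. -/
def pochRatio (s : ℕ) (y : ℚ) (l : ℕ) : ℚ :=
  ∏ j ∈ range l, ((s : ℚ) + 1 + j + y) / (1 + j + y)

/-- The polynomial in `l` which agrees with `(s + 1 + y)_l / (1 + y)_l`. -/
noncomputable def pochRatioPoly (s : ℕ) (y : ℚ) : ℚ[X] :=
  ∏ i ∈ range s, C (1 + i + y)⁻¹ * (X + C (1 + (i : ℚ) + y))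

lemma natDegree_pochRatioPoly_le (s : ℕ) (y : ℚ) : (pochRatioPoly s y).natDegree ≤ s := by
  refine (natDegree_prod_le _ _).trans ?_
  calc _ ≤ ∑ _i ∈ range s, 1 := sum_le_sum fun i _ =>
        (natDegree_C_mul_le _ _).trans (natDegree_X_add_C _).le
    _ = s := by simp

lemma pochRatio_eq_eval {s l : ℕ} {y : ℚ} (hy : ∀ j < s + l, 1 + (j : ℚ) + y ≠ 0) :
    pochRatio s y l = (pochRatioPoly s y).eval (l : ℚ) := by
  rw [pochRatio, pochRatioPoly, eval_prod]
  simp only [eval_mul, eval_C, eval_add, eval_X]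
  have h1 : ∏ j ∈ range l, (1 + (j : ℚ) + y) ≠ 0 :=
    prod_ne_zero_iff.mpr fun j hj => hy j (by have := mem_range.mp hj; omega)
  have h2 : ∏ j ∈ range s, (1 + (j : ℚ) + y) ≠ 0 :=
    prod_ne_zero_iff.mpr fun j hj => hy j (by have := mem_range.mp hj; omega)
  rw [prod_div_distrib, prod_mul_distrib, prod_inv_distrib, div_eq_iff h1, mul_assoc,
    eq_inv_mul_iff_mul_eq₀ h2]
  have e1 := prod_range_add (fun j : ℕ => 1 + (j : ℚ) + y) s l
  have e2 := prod_range_add (fun j : ℕ => 1 + (j : ℚ) + y) l s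
  rw [add_comm l s, e1, mul_comm (∏ j ∈ range l, _)] at e2
  have h3 : ∏ j ∈ range l, ((s : ℚ) + 1 + j + y) = ∏ j ∈ range l, (1 + ((s + j : ℕ) : ℚ) + y) :=
    prod_congr rfl fun j _ => by push_cast; ring
  have h4 : ∏ j ∈ range s, ((l : ℚ) + (1 + j + y)) = ∏ j ∈ range s, (1 + ((l + j : ℕ) : ℚ) + y) :=
    prod_congr rfl fun j _ => by push_cast; ring
  rw [h3, h4, e2, mul_comm]

lemma prod_sub_div_eq_choose (N l : ℕ) :
    ∏ j ∈ range l, ((j : ℚ) - N) / (1 + j) = (-1) ^ l * N.choose l := by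
  induction l with
  | zero => simp
  | succ l ih =>
    rw [prod_range_succ, ih]
    have h : ((N.choose (l + 1) : ℕ) : ℚ) * (l + 1) = N.choose l * (N - l) := by
      rcases le_or_gt l N with hl | hl
      · have := congrArg (Nat.cast (R := ℚ)) (Nat.choose_succ_right_eq N l)
        push_cast [hl] at this
        exact this
      · simp [Nat.choose_eq_zero_of_lt hl, Nat.choose_eq_zero_of_lt (hl.trans l.lt_succ_self)]
    have h0 : (1 + (l : ℚ)) ≠ 0 := by positivity
    field_simp
    linear_combination (-1) ^ l * h

lemma alternating_sum_choose_mul_eval_eq_zero {N : ℕ} {P : ℚ[X]} (hP : P.natDegree < N) :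
    ∑ l ∈ range (N + 1), (-1) ^ l * (N.choose l : ℚ) * P.eval (l : ℚ) = 0 := by
  have h := congrFun (fwdDiff_iter_eq_zero_of_degree_lt hP) 0
  rw [fwdDiff_iter_eq_sum_shift] at h
  simp only [zero_add, nsmul_eq_mul, mul_one, zsmul_eq_mul, Pi.zero_apply] at h
  rw [← mul_zero ((-1 : ℚ) ^ N), ← h, mul_sum]
  refine sum_congr rfl fun l hl => ?_
  obtain ⟨k, rfl⟩ := Nat.exists_eq_add_of_le (Nat.lt_succ_iff.mp (mem_range.mp hl))
  have : ((-1 : ℚ) ^ k) * (-1) ^ k = 1 := by rw [← mul_pow]; simp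
  push_cast
  rw [add_tsub_cancel_left, pow_add]
  linear_combination (-(-1) ^ l * ((l + k).choose l : ℚ) * P.eval (l : ℚ)) * this

/-- The summand of a Karlsson–Minton type hypergeometric sum with two free parameters. -/
def kmTerm (m s N : ℕ) (y z : ℚ) (l : ℕ) : ℚ :=
  (∏ j ∈ range l, ((j : ℚ) - N) / (1 + j)) * pochRatio s y l * pochRatio s z l *
    pochRatio s 0 l ^ m

lemma sum_kmTerm_eq_zero {m s N : ℕ} {y z : ℚ} (hN : s * (m + 2) < N)
    (hy : ∀ j < s + N, 1 + (j : ℚ) + y ≠ 0) (hz : ∀ j < s + N, 1 + (j : ℚ) + z ≠ 0) :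
    ∑ l ∈ range (N + 1), kmTerm m s N y z l = 0 := by
  set P := pochRatioPoly s y * pochRatioPoly s z * pochRatioPoly s 0 ^ m with hPdef
  have hP : P.natDegree < N := by
    refine lt_of_le_of_lt ?_ hN
    have h1 := natDegree_mul_le (p := pochRatioPoly s y * pochRatioPoly s z)
      (q := pochRatioPoly s 0 ^ m)
    have h2 := natDegree_mul_le (p := pochRatioPoly s y) (q := pochRatioPoly s z)
    have h3 := natDegree_pow_le_of_le m (natDegree_pochRatioPoly_le s 0)
    have h4 := natDegree_pochRatioPoly_le s y
    have h5 := natDegree_pochRatioPoly_le s z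
    rw [← hPdef] at h1
    nlinarith
  rw [← alternating_sum_choose_mul_eval_eq_zero hP]
  refine sum_congr rfl fun l hl => ?_
  have hl := mem_range.mp hl
  rw [kmTerm, prod_sub_div_eq_choose, pochRatio_eq_eval fun j hj => hy j (by omega),
    pochRatio_eq_eval fun j hj => hz j (by omega),
    pochRatio_eq_eval (y := 0) fun j _ => by positivity, hPdef]
  simp only [eval_mul, eval_pow]
  ring

end Vanishing
section Symmetry

variable {p : ℕ} [hp : Fact p.Prime]

lemma mul_sub_mul_mem {m : ℕ} {x x' y y' : ℚ} (hx' : x' ∈ localInt p) (hy : y ∈ localInt p)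
    (hx : x - x' ∈ powMultiples p m) (hyy : y - y' ∈ powMultiples p m) :
    x * y - x' * y' ∈ powMultiples p m := by
  have e : x * y - x' * y' = (x - x') * y + (y - y') * x' := by ring
  rw [e]
  exact add_mem (mul_mem_powMultiples hx hy) (mul_mem_powMultiples hyy hx')

lemma mem_of_sub_mem {S : AddSubgroup ℚ} {x y : ℚ} (h : x - y ∈ S) (hy : y ∈ S) : x ∈ S := by
  simpa using add_mem h hy

lemma pow_mul_mem_powMultiples_iff {m k : ℕ} {x : ℚ} :
    (p : ℚ) ^ m * x ∈ powMultiples p (m + k) ↔ x ∈ powMultiples p k := by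
  have h0 : (p : ℚ) ^ m ≠ 0 := pow_ne_zero _ cast_ne_zero
  simp only [mem_powMultiples, pow_add, mul_assoc, mul_right_inj' h0]

variable (p) in
/-- `UnitCongr p f g` says that `f ≡ g` modulo `g p ℤ_(p)`. -/
def UnitCongr (f g : ℚ) : Prop := ∃ r ∈ localInt p, f = g * (1 + p * r)

namespace UnitCongr

lemma refl (f : ℚ) : UnitCongr p f f := ⟨0, zero_mem _, by ring⟩

lemma mul {f g f' g' : ℚ} (h : UnitCongr p f g) (h' : UnitCongr p f' g') :
    UnitCongr p (f * f') (g * g') := by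
  obtain ⟨r, hr, rfl⟩ := h
  obtain ⟨t, ht, rfl⟩ := h'
  refine ⟨r + t + p * (r * t), ?_, by ring⟩
  exact add_mem (add_mem hr ht) (mul_mem (natCast_mem _ _) (mul_mem hr ht))

lemma inv {f g : ℚ} (h : UnitCongr p f g) : UnitCongr p f⁻¹ g⁻¹ := by
  obtain ⟨r, hr, rfl⟩ := h
  have h0 := one_add_mul_ne_zero hr
  refine ⟨-(r * (1 + p * r)⁻¹), neg_mem (mul_mem hr (inv_one_add_mul_mem hr)), ?_⟩
  rw [mul_inv]
  congr 1
  field_simp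
  ring

lemma div {f g f' g' : ℚ} (h : UnitCongr p f g) (h' : UnitCongr p f' g') :
    UnitCongr p (f / f') (g / g') := by
  rw [div_eq_mul_inv, div_eq_mul_inv]
  exact h.mul h'.inv

lemma prod {f g : ℕ → ℚ} {l : ℕ} (h : ∀ j < l, UnitCongr p (f j) (g j)) :
    UnitCongr p (∏ j ∈ range l, f j) (∏ j ∈ range l, g j) := by
  induction l with
  | zero => exact refl 1
  | succ l ih =>
    rw [prod_range_succ, prod_range_succ]
    exact mul (ih fun j hj => h j (hj.trans l.lt_succ_self)) (h l l.lt_succ_self)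

lemma pow {f g : ℚ} (h : UnitCongr p f g) (n : ℕ) : UnitCongr p (f ^ n) (g ^ n) := by
  simpa using prod (f := fun _ => f) (g := fun _ => g) (l := n) fun _ _ => h

lemma sub_mem {f g : ℚ} (hg : g ∈ localInt p) (h : UnitCongr p f g) :
    f - g ∈ powMultiples p 1 := by
  obtain ⟨r, hr, rfl⟩ := h
  exact mem_powMultiples.mpr ⟨g * r, mul_mem hg hr, by ring⟩

lemma add_mul {a w : ℚ} (ha0 : a ≠ 0) (ha : a⁻¹ ∈ localInt p) (hw : w ∈ localInt p) :
    UnitCongr p (a + p * w) a := by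
  refine ⟨w * a⁻¹, mul_mem hw ha, ?_⟩
  field_simp

end UnitCongr

/-- The power sum `∑_{j < l} 1 / (s + 1 + j) ^ 2`. -/
def invSqSum (s l : ℕ) : ℚ := ∑ j ∈ range l, (((s : ℚ) + 1 + j) ^ 2)⁻¹

lemma shift_ne_zero (s j : ℕ) : (s : ℚ) + 1 + j ≠ 0 := by positivity

lemma shift_inv_mem {s j : ℕ} (h : s + 1 + j < p) : ((s : ℚ) + 1 + j)⁻¹ ∈ localInt p := by
  exact_mod_cast natCast_inv_mem (a := s + 1 + j) (by omega) h

lemma invSqSum_mem {s l : ℕ} (h : s + l < p) : invSqSum s l ∈ localInt p := by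
  refine sum_mem fun j hj => ?_
  rw [← inv_pow]
  exact pow_mem (shift_inv_mem (by have := mem_range.mp hj; omega)) 2

lemma shift_mem (s j : ℕ) : (s : ℚ) + 1 + j ∈ localInt p := by
  exact_mod_cast natCast_mem (localInt p) (s + 1 + j)

lemma pochRatio_zero_mem {s l : ℕ} (h : l < p) : pochRatio s 0 l ∈ localInt p := by
  refine prod_mem fun j hj => ?_
  have hj := mem_range.mp hj
  rw [div_eq_mul_inv, add_zero, add_zero]
  refine mul_mem (shift_mem s j) ?_
  simpa using shift_inv_mem (p := p) (s := 0) (j := j) (by omega)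

lemma pochRatio_unitCongr {s l : ℕ} {w : ℚ} (hw : w ∈ localInt p) (h : s + l < p) :
    UnitCongr p (pochRatio s (p * w) l) (pochRatio s 0 l) := by
  refine UnitCongr.prod fun j hj => ?_
  have h1 := UnitCongr.add_mul (shift_ne_zero s j) (shift_inv_mem (p := p) (by omega)) hw
  have h2 := UnitCongr.add_mul (shift_ne_zero 0 j) (shift_inv_mem (p := p) (by omega)) hw
  simpa using h1.div h2

lemma kmTerm_unitCongr {m s N l : ℕ} {w v : ℚ} (hw : w ∈ localInt p) (hv : v ∈ localInt p)
    (hN : N + s + 1 = p) (h : l ≤ N) :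
    UnitCongr p (kmTerm m s N (p * w) (p * v) l) (pochRatio s 0 l ^ (m + 3)) := by
  have h1 : UnitCongr p (∏ j ∈ range l, ((j : ℚ) - N) / (1 + j)) (pochRatio s 0 l) := by
    refine UnitCongr.prod fun j hj => ?_
    have h1 := UnitCongr.add_mul (shift_ne_zero s j) (shift_inv_mem (p := p) (by omega))
      (neg_mem (one_mem _))
    convert h1.div (UnitCongr.refl (p := p) (1 + j)) using 2
    · rw [← hN]; push_cast; ring
    · ring
    · ring
  have h2 := pochRatio_unitCongr hw (show s + l < p by omega)
  have h3 := pochRatio_unitCongr hv (show s + l < p by omega)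
  convert ((h1.mul h2).mul h3).mul (UnitCongr.refl (p := p) (pochRatio s 0 l ^ m)) using 1
  · rfl
  · ring

lemma pochRatio_reflect {s N l : ℕ} (hN : N + s + 1 = p) (hl : l ≤ N) :
    UnitCongr p (pochRatio s 0 (N - l)) ((-1) ^ s * pochRatio s 0 l) := by
  rw [pochRatio_eq_eval fun j _ => by positivity, pochRatio_eq_eval fun j _ => by positivity,
    pochRatioPoly, eval_prod, eval_prod]
  simp only [eval_mul, eval_C, eval_add, eval_X]
  rw [prod_mul_distrib, prod_mul_distrib, mul_left_comm]
  refine (UnitCongr.refl _).mul ?_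
  have e : (-1) ^ s * ∏ i ∈ range s, ((l : ℚ) + (1 + i + 0)) =
      ∏ i ∈ range s, (-((l : ℚ) + 1 + i)) := by
    rw [prod_neg, card_range]; simp [add_assoc]
  rw [e, ← prod_range_reflect]
  refine UnitCongr.prod fun i hi => ?_
  have h1 := UnitCongr.add_mul (a := -((l : ℚ) + 1 + i)) (neg_ne_zero.mpr (shift_ne_zero l i))
    (by rw [inv_neg]; exact neg_mem (shift_inv_mem (p := p) (by omega))) (one_mem _)
  convert h1 using 1
  rw [← hN, Nat.sub_sub, Nat.cast_sub hl, Nat.cast_sub (by omega)]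
  push_cast
  ring

lemma invSqSum_reflect {s N l : ℕ} (hN : N + s + 1 = p) (hl : l ≤ N) :
    invSqSum s (N - l) - (invSqSum 0 N - invSqSum 0 l) ∈ powMultiples p 1 := by
  have e : invSqSum 0 N - invSqSum 0 l = ∑ j ∈ range (N - l), (((l : ℚ) + 1 + j) ^ 2)⁻¹ := by
    obtain ⟨k, rfl⟩ := Nat.exists_eq_add_of_le hl
    rw [invSqSum, invSqSum, sum_range_add, add_sub_cancel_left, add_tsub_cancel_left]
    refine sum_congr rfl fun j _ => ?_
    push_cast; ring
  rw [e, invSqSum, ← sum_range_reflect, ← sum_sub_distrib]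
  refine sum_mem fun j hj => ?_
  have hj := mem_range.mp hj
  have h0 := shift_ne_zero l j
  have hi := shift_inv_mem (p := p) (s := l) (j := j) (by omega)
  have h1 := shift_ne_zero s (N - l - 1 - j)
  have hi1 := shift_inv_mem (p := p) (s := s) (j := N - l - 1 - j) (by omega)
  have e : (s : ℚ) + 1 + (N - l - 1 - j : ℕ) = p - (l + 1 + j) := by
    rw [← hN, Nat.sub_sub, Nat.sub_sub, Nat.cast_sub (by omega)]
    push_cast
    ring
  rw [e] at h1 hi1 ⊢
  have hm := shift_mem (p := p) l j
  have hP : (p : ℚ) ∈ localInt p := natCast_mem _ _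
  generalize (l : ℚ) + 1 + j = x at *
  refine mem_powMultiples.mpr ⟨(2 * x - p) * x⁻¹ ^ 2 * (p - x)⁻¹ ^ 2, ?_, ?_⟩
  · have h2 : (2 : ℚ) ∈ localInt p := by exact_mod_cast natCast_mem (localInt p) 2
    apply_rules [mul_mem, pow_mem, _root_.sub_mem]
  · field_simp
    ring

end Symmetry

section Supercongruence

variable {p : ℕ} [hp : Fact p.Prime]

lemma sum_relCongr_sub_mem {f g c : ℕ → ℚ} {N : ℕ} (hg : ∀ l ≤ N, g l ∈ localInt p)
    (h : ∀ l ≤ N, RelCongr p (f l) (g l) (c l)) :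
    ∑ l ∈ range (N + 1), f l - ∑ l ∈ range (N + 1), g l -
      (p : ℚ) ^ 2 * ∑ l ∈ range (N + 1), g l * c l ∈ powMultiples p 3 := by
  rw [mul_sum, ← sum_sub_distrib, ← sum_sub_distrib]
  refine sum_mem fun l hl => ?_
  have hl := Nat.lt_succ_iff.mp (mem_range.mp hl)
  obtain ⟨r, hr, e⟩ := h l hl
  rw [e]
  exact mem_powMultiples.mpr ⟨g l * r, mul_mem (hg l hl) hr, by ring⟩

lemma kmTerm_mem {m s N l : ℕ} {w v : ℚ} (hw : w ∈ localInt p) (hv : v ∈ localInt p)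
    (hN : N + s + 1 = p) (hl : l ≤ N) : kmTerm m s N (p * w) (p * v) l ∈ localInt p := by
  obtain ⟨r, hr, e⟩ := kmTerm_unitCongr (m := m) hw hv hN hl
  rw [e]
  exact mul_mem (pow_mem (pochRatio_zero_mem (by omega)) _)
    (add_mem (one_mem _) (mul_mem (natCast_mem _ _) hr))

lemma sum_kmTerm_mul_sub_mem {m s N : ℕ} {w v : ℚ} {c : ℕ → ℚ} (hw : w ∈ localInt p)
    (hv : v ∈ localInt p) (hc : ∀ l ≤ N, c l ∈ localInt p) (hN : N + s + 1 = p) :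
    ∑ l ∈ range (N + 1), kmTerm m s N (p * w) (p * v) l * c l -
      ∑ l ∈ range (N + 1), pochRatio s 0 l ^ (m + 3) * c l ∈ powMultiples p 1 := by
  rw [← sum_sub_distrib]
  refine sum_mem fun l hl => ?_
  have hl := Nat.lt_succ_iff.mp (mem_range.mp hl)
  rw [← sub_mul]
  exact mul_mem_powMultiples (UnitCongr.sub_mem (pow_mem (pochRatio_zero_mem (by omega)) _)
    (kmTerm_unitCongr hw hv hN hl)) (hc l hl)

lemma sum_kmTerm_eq_zero_of_mem {m s N : ℕ} {w v : ℚ} (hw : w ∈ localInt p) (hv : v ∈ localInt p)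
    (hN : N + s + 1 = p) (hdeg : s * (m + 2) < N) :
    ∑ l ∈ range (N + 1), kmTerm m s N (p * w) (p * v) l = 0 := by
  have key : ∀ w ∈ localInt p, ∀ j < s + N, 1 + (j : ℚ) + p * w ≠ 0 := by
    intro w hw j hj h
    have h0 := shift_ne_zero 0 j
    have hi := shift_inv_mem (p := p) (s := 0) (j := j) (by omega)
    refine one_add_mul_ne_zero (mul_mem hw hi) ?_
    push_cast at h0 ⊢
    field_simp
    linear_combination h
  exact sum_kmTerm_eq_zero hdeg (key w hw) (key v hv)

lemma relCongr_kmTerm_neg {m s N l : ℕ} (hN : N + s + 1 = p) (hl : l ≤ N) :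
    RelCongr p (kmTerm m s N (p * 1) (p * (-1)) l) (kmTerm m s N (p * 0) (p * 0) l)
      (invSqSum 0 l - invSqSum s l) := by
  have hcm : ∀ a : ℚ, a⁻¹ ∈ localInt p → a⁻¹ * (-a⁻¹) ∈ localInt p := fun a ha =>
    mul_mem ha (neg_mem ha)
  have factor : ∀ a : ℚ, a ≠ 0 → a⁻¹ ∈ localInt p →
      RelCongr p ((a + p) * (a - p)) (a * a) (a⁻¹ * (-a⁻¹)) := by
    intro a ha0 ha
    convert (RelCongr.one_add_mul_one_add ha (neg_mem ha)).const_mul (a * a) using 1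
    · field_simp
      ring
    · ring
  have h : RelCongr p (pochRatio s (p * 1) l * pochRatio s (p * (-1)) l)
      (pochRatio s (p * 0) l * pochRatio s (p * 0) l) (invSqSum 0 l - invSqSum s l) := by
    simp only [pochRatio, ← prod_mul_distrib, invSqSum, ← sum_sub_distrib]
    have ha : ∀ j < l, ((s : ℚ) + 1 + j)⁻¹ ∈ localInt p := fun j hj => shift_inv_mem (by omega)
    have hb : ∀ j < l, (((0 : ℕ) : ℚ) + 1 + j)⁻¹ ∈ localInt p := fun j hj =>
      shift_inv_mem (by omega)
    refine RelCongr.prod (fun j hj => ?_) fun j hj => ?_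
    · simp only [← inv_pow]
      exact sub_mem (pow_mem (hb j hj) 2) (pow_mem (ha j hj) 2)
    · convert RelCongr.div (hcm _ (ha j hj)) (hcm _ (hb j hj))
        (factor _ (shift_ne_zero s j) (ha j hj)) (factor _ (shift_ne_zero 0 j) (hb j hj)) using 1
      · push_cast; rw [div_mul_div_comm]; ring_nf
      · push_cast; rw [div_mul_div_comm]; ring_nf
      · simp only [← inv_pow]
        push_cast; ring
  convert h.const_mul ((∏ j ∈ range l, ((j : ℚ) - N) / (1 + j)) * pochRatio s 0 l ^ m) using 1 <;>
  · rw [kmTerm]; ring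

lemma sum_pochRatio_mul_invSqSum_mem {m s N : ℕ} (hN : N + s + 1 = p) (hdeg : s * (m + 2) < N)
    (hpar : Even s ∨ Even (m + 3)) (hp2 : 2 < p) :
    ∑ l ∈ range (N + 1), pochRatio s 0 l ^ (m + 3) * invSqSum 0 l ∈ powMultiples p 1 ∧
      ∑ l ∈ range (N + 1), pochRatio s 0 l ^ (m + 3) * invSqSum s l ∈ powMultiples p 1 := by
  have h2p : (2 : ℚ)⁻¹ ∈ localInt p := by
    exact_mod_cast natCast_inv_mem (p := p) two_pos hp2
  have z0 := zero_mem (localInt p)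
  have z1 := one_mem (localInt p)
  have hH0 : ∀ l ≤ N, invSqSum 0 l ∈ localInt p := fun l hl => invSqSum_mem (by omega)
  have hHs : ∀ l ≤ N, invSqSum s l ∈ localInt p := fun l hl => invSqSum_mem (by omega)
  have hdiff : ∑ l ∈ range (N + 1), pochRatio s 0 l ^ (m + 3) * (invSqSum 0 l - invSqSum s l) ∈
      powMultiples p 1 := by
    have h1 := sum_relCongr_sub_mem (fun l hl => kmTerm_mem (m := m) z0 z0 hN hl)
      fun l hl => relCongr_kmTerm_neg (m := m) hN hl
    rw [sum_kmTerm_eq_zero_of_mem z1 (neg_mem z1) hN hdeg, sum_kmTerm_eq_zero_of_mem z0 z0 hN hdeg,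
      sub_zero, zero_sub, neg_mem_iff] at h1
    have h2 := (pow_mul_mem_powMultiples_iff (m := 2) (k := 1)).mp h1
    have h3 := sum_kmTerm_mul_sub_mem (m := m) z0 z0
      (fun l hl => sub_mem (hH0 l hl) (hHs l hl)) hN
    simpa using sub_mem h2 h3
  have hsum : ∑ l ∈ range (N + 1), pochRatio s 0 l ^ (m + 3) ∈ powMultiples p 1 := by
    have h3 := sum_kmTerm_mul_sub_mem (m := m) (c := fun _ => 1) z0 z0 (fun _ _ => z1) hN
    simp only [mul_one] at h3
    rwa [sum_kmTerm_eq_zero_of_mem z0 z0 hN hdeg, zero_sub, neg_mem_iff] at h3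
  have hrefl : ∑ l ∈ range (N + 1), pochRatio s 0 l ^ (m + 3) * invSqSum s l -
      ∑ l ∈ range (N + 1), pochRatio s 0 l ^ (m + 3) * (invSqSum 0 N - invSqSum 0 l) ∈
        powMultiples p 1 := by
    rw [← sum_range_reflect, ← sum_sub_distrib]
    refine sum_mem fun l hl => ?_
    have hl := Nat.lt_succ_iff.mp (mem_range.mp hl)
    rw [Nat.add_sub_cancel]
    have hu := pow_mem (pochRatio_zero_mem (p := p) (s := s) (l := l) (by omega)) (m + 3)
    refine mul_sub_mul_mem hu (hHs _ (N.sub_le l)) ?_ (invSqSum_reflect hN hl)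
    have h := (pochRatio_reflect hN hl).pow (m + 3)
    have hsign : ((-1 : ℚ) ^ s) ^ (m + 3) = 1 := by
      rw [← pow_mul]
      exact (Nat.even_mul.mpr hpar).neg_one_pow
    rw [mul_pow, hsign, one_mul] at h
    exact h.sub_mem hu
  have hs : ∑ l ∈ range (N + 1), pochRatio s 0 l ^ (m + 3) * invSqSum s l ∈ powMultiples p 1 := by
    have h := mul_mem_powMultiples (sub_mem (add_mem hrefl
      (mul_mem_powMultiples hsum (hH0 N le_rfl))) hdiff) h2p
    convert h using 1
    simp only [mul_sub, sum_sub_distrib, ← sum_mul]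
    ring
  refine ⟨?_, hs⟩
  convert add_mem hdiff hs using 1
  simp only [mul_sub, sum_sub_distrib]
  ring

lemma relCongr_denominator {m : ℕ} {b : ℚ} (hb0 : b ≠ 0) (hb : b⁻¹ ∈ localInt p) :
    RelCongr p ((b - p) ^ (m + 3)) ((b - (m + 3 : ℕ) * p) * b ^ (m + 2))
      ((m + 3).choose 2 * (b ^ 2)⁻¹) := by
  convert (RelCongr.one_add_pow (neg_mem hb) (m + 3)).const_mul (b ^ (m + 3)) using 1
  · rw [← mul_pow]
    congr 1
    field_simp
    ring
  · push_cast
    field_simp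
    ring
  · ring

lemma relCongr_numerator {m : ℕ} {a : ℚ} (ha0 : a ≠ 0) (ha : a⁻¹ ∈ localInt p)
    (hni : ((m + 3 : ℕ) : ℚ)⁻¹ ∈ localInt p) :
    RelCongr p ((a - p / (m + 3 : ℕ) - p) ^ (m + 3))
      ((a - p) * (a - (m + 3 : ℕ) * p) * a ^ (m + 1))
      (((m + 3).choose 2 * (1 + ((m + 3 : ℕ) : ℚ)⁻¹) ^ 2 - (m + 3 : ℕ)) * (a ^ 2)⁻¹) := by
  have hn0 : ((m + 3 : ℕ) : ℚ) ≠ 0 := by positivity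
  have hnm : ((m + 3 : ℕ) : ℚ) ∈ localInt p := natCast_mem _ _
  have hcm : (((m + 3).choose 2 : ℕ) : ℚ) ∈ localInt p := natCast_mem _ _
  have hz : (1 + ((m + 3 : ℕ) : ℚ)⁻¹) ∈ localInt p := add_mem (one_mem _) hni
  have hz' : -((1 + ((m + 3 : ℕ) : ℚ)⁻¹) * a⁻¹) ∈ localInt p := neg_mem (mul_mem hz ha)
  have hv : -(((m + 3 : ℕ) : ℚ) * a⁻¹) ∈ localInt p := neg_mem (mul_mem hnm ha)
  have h1 := RelCongr.one_add_pow hz' (m + 3)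
  have h2 := RelCongr.one_add_mul_one_add (neg_mem ha) hv
  have e : -a⁻¹ + -(((m + 3 : ℕ) : ℚ) * a⁻¹) =
      (m + 3 : ℕ) * -((1 + ((m + 3 : ℕ) : ℚ)⁻¹) * a⁻¹) := by
    field_simp
    ring
  rw [e] at h2
  have hwv := mul_mem (neg_mem ha) hv
  convert (h1.trans (mul_mem hcm (pow_mem hz' 2)) (neg_mem hwv) (h2.symm hwv)).const_mul
    (a ^ (m + 3)) using 1
  · rw [← mul_pow]
    congr 1
    field_simp
    ring
  · generalize ((m + 3 : ℕ) : ℚ) = c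
    field_simp
    ring
  · ring

lemma relCongr_summand {m s N l : ℕ} (hN : N + s + 1 = p) (hl : l ≤ N) (hn : m + 3 < p) :
    RelCongr p ((∏ j ∈ range l, ((s : ℚ) + 1 + j - p / (m + 3 : ℕ) - p) / (1 + j - p)) ^ (m + 3))
      (kmTerm m s N (p * (-(m + 3 : ℕ))) (p * 0) l)
      (((m + 3).choose 2 * (1 + ((m + 3 : ℕ) : ℚ)⁻¹) ^ 2 - (m + 3 : ℕ)) * invSqSum s l
        - (m + 3).choose 2 * invSqSum 0 l) := by
  have hni : ((m + 3 : ℕ) : ℚ)⁻¹ ∈ localInt p := natCast_inv_mem (by omega) hn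
  have ha : ∀ j < l, ((s : ℚ) + 1 + j)⁻¹ ∈ localInt p := fun j hj => shift_inv_mem (by omega)
  have hb : ∀ j < l, (((0 : ℕ) : ℚ) + 1 + j)⁻¹ ∈ localInt p := fun j hj =>
    shift_inv_mem (by omega)
  have hnm : ((m + 3 : ℕ) : ℚ) ∈ localInt p := natCast_mem _ _
  have hcm : (((m + 3).choose 2 : ℕ) : ℚ) ∈ localInt p := natCast_mem _ _
  have hpN : (p : ℚ) = N + s + 1 := by rw [← hN]; push_cast; ring
  have e : kmTerm m s N (p * (-(m + 3 : ℕ))) (p * 0) l = ∏ j ∈ range l,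
      (((s : ℚ) + 1 + j - p) * ((s : ℚ) + 1 + j - (m + 3 : ℕ) * p) * ((s : ℚ) + 1 + j) ^ (m + 1)) /
        ((((0 : ℕ) : ℚ) + 1 + j - (m + 3 : ℕ) * p) * (((0 : ℕ) : ℚ) + 1 + j) ^ (m + 2)) := by
    simp only [kmTerm, pochRatio, ← prod_mul_distrib, ← prod_pow]
    refine prod_congr rfl fun j _ => ?_
    have hjN : (j : ℚ) - N = s + 1 + j - p := by rw [hpN]; ring
    have hc : (p : ℚ) * -((m + 3 : ℕ) : ℚ) = -((m + 3 : ℕ) * p) := by ring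
    rw [hjN, hc]
    simp only [div_eq_mul_inv, mul_inv, mul_zero, add_zero, Nat.cast_zero, zero_add,
      ← sub_eq_add_neg]
    generalize (s : ℚ) + 1 + j = a
    generalize ((m + 3 : ℕ) : ℚ) * p = c
    generalize (1 : ℚ) + j = b
    generalize b - c = d
    ring
  have hz : 1 + ((m + 3 : ℕ) : ℚ)⁻¹ ∈ localInt p := add_mem (one_mem _) hni
  rw [e, ← prod_pow, invSqSum, invSqSum, mul_sum, mul_sum, ← sum_sub_distrib]
  refine RelCongr.prod (fun j hj => ?_) fun j hj => ?_
  · have := ha j hj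
    have := hb j hj
    simp only [← inv_pow]
    apply_rules [sub_mem, mul_mem, pow_mem]
  · have h := RelCongr.div ?_ ?_ (relCongr_numerator (m := m) (shift_ne_zero s j) (ha j hj) hni)
      (relCongr_denominator (m := m) (shift_ne_zero 0 j) (hb j hj))
    · convert h using 1
      rw [div_pow]; push_cast; ring_nf
    all_goals
      have := ha j hj
      have := hb j hj
      simp only [← inv_pow]
      apply_rules [sub_mem, mul_mem, pow_mem]

lemma prod_mem_powMultiples_one {s N k n : ℕ} (hN : N + s + 1 = p) (hNk : N < k) (hkp : k < p)
    (hni : (n : ℚ)⁻¹ ∈ localInt p) :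
    ∏ j ∈ range k, ((s : ℚ) + 1 + j - p / n - p) / (1 + j - p) ∈ powMultiples p 1 := by
  have hP : (p : ℚ) ∈ localInt p := natCast_mem _ _
  have hden : ∀ j < k, (1 + (j : ℚ) - p)⁻¹ ∈ localInt p := by
    intro j hj
    have h := neg_mem (natCast_inv_mem (p := p) (a := p - (1 + j)) (by omega) (by omega))
    rw [Nat.cast_sub (by omega), ← inv_neg, neg_sub] at h
    exact_mod_cast h
  rw [← mul_prod_erase _ _ (mem_range.mpr hNk)]
  refine mul_mem_powMultiples ?_ (prod_mem fun j hj => ?_)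
  · refine mem_powMultiples.mpr
      ⟨-(n : ℚ)⁻¹ * (1 + (N : ℚ) - p)⁻¹, mul_mem (neg_mem hni) (hden N hNk), ?_⟩
    have e : (s : ℚ) + 1 + N - p / n - p = p * -(n : ℚ)⁻¹ := by
      have : (p : ℚ) = N + s + 1 := by rw [← hN]; push_cast; ring
      rw [div_eq_mul_inv]
      linear_combination -this
    rw [e]
    ring
  · rw [div_eq_mul_inv, div_eq_mul_inv]
    have h1 := hden j (mem_range.mp (mem_of_mem_erase hj))
    clear hden
    have h2 := shift_mem (p := p) s j
    apply_rules [mul_mem, sub_mem]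

lemma sum_prod_pow_mem_powMultiples {m s N : ℕ} (hN : N + s + 1 = p) (hdeg : s * (m + 2) < N)
    (hpar : Even s ∨ Even (m + 3)) (hn : m + 3 < p) :
    ∑ k ∈ range p,
      (∏ j ∈ range k, ((s : ℚ) + 1 + j - p / (m + 3 : ℕ) - p) / (1 + j - p)) ^ (m + 3) ∈
        powMultiples p 3 := by
  have hni : ((m + 3 : ℕ) : ℚ)⁻¹ ∈ localInt p := natCast_inv_mem (by omega) hn
  have hnm : ((m + 3 : ℕ) : ℚ) ∈ localInt p := natCast_mem _ _
  have hcm : (((m + 3).choose 2 : ℕ) : ℚ) ∈ localInt p := natCast_mem _ _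
  have hz : 1 + ((m + 3 : ℕ) : ℚ)⁻¹ ∈ localInt p := add_mem (one_mem _) hni
  have z0 := zero_mem (localInt p)
  have hκ := sub_mem (mul_mem hcm (pow_mem hz 2)) hnm
  have hrange : range p = range (N + 1 + s) := by rw [← hN]; congr 1; ring
  rw [hrange, sum_range_add]
  refine add_mem ?_ (sum_mem fun k hk => ?_)
  · have h1 := sum_relCongr_sub_mem (fun l hl => kmTerm_mem (m := m) (neg_mem hnm) z0 hN hl)
      fun l hl => relCongr_summand (m := m) hN hl hn
    rw [sum_kmTerm_eq_zero_of_mem (neg_mem hnm) z0 hN hdeg, sub_zero] at h1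
    refine mem_of_sub_mem h1 ?_
    rw [show 3 = 2 + 1 from rfl, pow_mul_mem_powMultiples_iff]
    have h2 := sum_kmTerm_mul_sub_mem (m := m) (neg_mem hnm) z0 (fun l hl => sub_mem
      (mul_mem hκ (invSqSum_mem (s := s) (l := l) (by omega)))
      (mul_mem hcm (invSqSum_mem (s := 0) (l := l) (by omega)))) hN
    refine mem_of_sub_mem h2 ?_
    obtain ⟨h3, h4⟩ := sum_pochRatio_mul_invSqSum_mem hN hdeg hpar (by omega)
    convert sub_mem (mul_mem_powMultiples h4 hκ) (mul_mem_powMultiples h3 hcm) using 1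
    simp only [sum_mul, ← sum_sub_distrib]
    exact sum_congr rfl fun l _ => by ring
  · have hk := mem_range.mp hk
    obtain ⟨r, hr, e⟩ := mem_powMultiples.mp
      (prod_mem_powMultiples_one (k := N + 1 + k) hN (by omega) (by omega) hni)
    rw [e]
    exact mem_powMultiples.mpr ⟨p ^ m * r ^ (m + 3),
      mul_mem (pow_mem (natCast_mem _ _) _) (pow_mem hr _), by ring⟩

end Supercongruence

lemma ascPochhammer_eval_eq_prod_add (x : ℚ) (k : ℕ) :
    (ascPochhammer ℚ k).eval x = ∏ j ∈ range k, (x + j) := by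
  induction k with
  | zero => simp
  | succ k ih => rw [ascPochhammer_succ_eval, ih, prod_range_succ]

end PochhammerSum

/-- For integers `n > 2` and `q > 1` with `n` even or `q` odd, and any prime
`p > max {n, (q-1)n+1}`, the rational number
`∑_{k=0}^{p-1} (q - p/n - p)_k^n / (1-p)_k^n`
is congruent to `0` modulo `p^3`, i.e. it can be written as `p^3 * a / b` with `p ∤ b`. -/
theorem stmt_19 (n q : ℕ) (hn : 2 < n) (hq : 1 < q) (hpar : Even n ∨ Odd q)
    (p : ℕ) (hp : p.Prime) (hgt : p > max n ((q - 1) * n + 1)) :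
    ∃ a b : ℤ, ¬ ((p : ℤ) ∣ b) ∧
      ∑ k ∈ Finset.range p,
          ((ascPochhammer ℚ k).eval ((q : ℚ) - (p : ℚ) / (n : ℚ) - (p : ℚ))) ^ n /
            ((ascPochhammer ℚ k).eval (1 - (p : ℚ))) ^ n
        = (p : ℚ) ^ 3 * a / b := by
  have : Fact p.Prime := ⟨hp⟩
  obtain ⟨m, rfl⟩ := Nat.exists_eq_add_of_le' hn
  obtain ⟨s, rfl⟩ := Nat.exists_eq_add_of_le' hq.le
  have h1 : m + 3 < p := lt_of_le_of_lt (le_max_left _ _) hgt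
  have h2 : s * (m + 3) + 1 < p := by
    simpa using lt_of_le_of_lt (le_max_right _ _) hgt
  have h3 : s * (m + 3) = s * (m + 2) + s := by ring
  have hpar' : Even s ∨ Even (m + 3) := by
    rcases hpar with h | h
    · exact Or.inr h
    · exact Or.inl (by simpa [Nat.odd_add_one] using h)
  have h := PochhammerSum.sum_prod_pow_mem_powMultiples (p := p) (m := m) (s := s)
    (N := p - s - 1) (by omega) (by omega) hpar' h1
  obtain ⟨r, ⟨a, b, hb, rfl⟩, e⟩ := PochhammerSum.mem_powMultiples.mp h
  refine ⟨a, b, hb, ?_⟩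
  rw [mul_div_assoc, ← e]
  refine Finset.sum_congr rfl fun k _ => ?_
  rw [← div_pow, PochhammerSum.ascPochhammer_eval_eq_prod_add,
    PochhammerSum.ascPochhammer_eval_eq_prod_add, ← Finset.prod_div_distrib]
  congr 1
  refine Finset.prod_congr rfl fun j _ => ?_
  push_cast
  congr 1 <;> ring
end
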